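/- For every ε > 0 and every integer r ≥ 2, there exist a constant K' = K'(r, ε) and n₀ such that the following holds for all n ≥ n₀. Let p = K' n^{−1/r}, let G(n,p) be the binomial random graph on n vertices, and color the edges of G(n,p) independently and uniformly at random with q ≥ rn colors. Then with probability at least 1 − ε, the resulting colored graph contains a rainbow r-th power of a Hamilton cycle, i.e. an r-th power of a Hamilton cycle in which no two edges receive the same color. -/

import Mathlib

open Finset
open scoped Classical

/-- The edge `{v_i, v_{i+d}}` of the `r`-th power of the Hamilton cycle determined by the
cyclic vertex ordering `σ` of the `n` vertices, indices modulo `n`. -/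
noncomputable def powEdge (n : ℕ) [NeZero n] (σ : Equiv.Perm (ZMod n)) (i d : ℕ) :
    Finset (ZMod n) :=
  {σ ((i : ℕ) : ZMod n), σ (((i + d : ℕ) : ZMod n))}

/-- The probability that the random graph `G(n,p)` on vertex set `ZMod n` (each pair an
edge independently with probability `p`), whose edges are colored independently and
uniformly at random with `qc` colors, contains a rainbow `r`-th power of a Hamilton cycle:
a cyclic ordering `σ` of the vertices such that all pairs at cyclic distance at most `r`
are edges and these edges receive pairwise distinct colors. -/
noncomputable def rainbowPowHamProb (n r qc : ℕ) [NeZero n] (p : ℝ) : ℝ :=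
  ∑ E ∈ (Finset.univ.filter fun S : Finset (ZMod n) => S.card = 2).powerset,
    ∑ c : Finset (ZMod n) → Fin qc,
      p ^ E.card *
        (1 - p) ^ ((Finset.univ.filter fun S : Finset (ZMod n) => S.card = 2).card - E.card) *
        ((qc : ℝ) ^ Fintype.card (Finset (ZMod n)))⁻¹ *
        (if ∃ σ : Equiv.Perm (ZMod n),
            (∀ i < n, ∀ d, 1 ≤ d → d ≤ r → powEdge n σ i d ∈ E) ∧
            (∀ i < n, ∀ d, 1 ≤ d → d ≤ r → ∀ i' < n, ∀ d', 1 ≤ d' → d' ≤ r →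
              c (powEdge n σ i d) = c (powEdge n σ i' d') →
                powEdge n σ i d = powEdge n σ i' d')
          then 1 else 0)

section Bernoulli

variable {Y : Type*} [Fintype Y] [DecidableEq Y]

/-- The probability that the `p`-random subset of `Y` equals `W`. -/
noncomputable def bernoulliWeight (p : ℝ) (W : Finset Y) : ℝ :=
  ∏ z, if z ∈ W then p else 1 - p

theorem sum_prod_ite_mem (f g : Y → ℝ) :
    ∑ W : Finset Y, ∏ z, (if z ∈ W then f z else g z) = ∏ z, (f z + g z) := by
  rw [Finset.prod_add, Finset.powerset_univ]
  refine Finset.sum_congr rfl fun W _ => ?_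
  rw [Finset.prod_ite]
  congr 1
  · congr 1; ext; simp
  · congr 1; ext; simp

theorem bernoulliWeight_nonneg {p : ℝ} (hp : 0 ≤ p) (hp1 : p ≤ 1) (W : Finset Y) :
    0 ≤ bernoulliWeight p W := by
  refine Finset.prod_nonneg fun z _ => ?_
  split_ifs <;> linarith

theorem sum_bernoulliWeight (p : ℝ) : ∑ W : Finset Y, bernoulliWeight p W = 1 := by
  simp [bernoulliWeight, sum_prod_ite_mem (Y := Y) (fun _ => p) (fun _ => 1 - p)]

theorem sum_bernoulliWeight_superset (p : ℝ) (I : Finset Y) :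
    ∑ W : Finset Y, bernoulliWeight p W * (if I ⊆ W then 1 else 0) = p ^ #I := by
  have h : ∀ W : Finset Y, bernoulliWeight p W * (if I ⊆ W then 1 else 0) =
      ∏ z, (if z ∈ W then p else (if z ∈ I then 0 else 1 - p)) := by
    intro W
    split_ifs with hI
    · rw [mul_one]
      refine Finset.prod_congr rfl fun z _ => ?_
      by_cases hz : z ∈ W
      · simp [hz]
      · have : z ∉ I := fun h => hz (hI h)
        simp [hz, this]
    · obtain ⟨z, hz, hz'⟩ := Finset.not_subset.1 hI
      rw [mul_zero, eq_comm]
      exact Finset.prod_eq_zero (Finset.mem_univ z) (by simp [hz, hz'])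
  simp_rw [h]
  rw [sum_prod_ite_mem (fun _ => p) (fun z => if z ∈ I then 0 else 1 - p)]
  have h2 : ∀ z, p + (if z ∈ I then 0 else 1 - p) = if z ∈ I then p else 1 := by
    intro z; split_ifs <;> ring
  simp_rw [h2]
  simp [Finset.prod_ite_mem]

theorem bernoulliWeight_mul_pow_le {p : ℝ} (hp : 0 ≤ p) (hp1 : p ≤ 1) {W I : Finset Y}
    (h : Disjoint I W) : bernoulliWeight p W * p ^ #I ≤ bernoulliWeight p (W ∪ I) := by
  have h1 : p ^ #I = ∏ z, if z ∈ I then p else 1 := by simp [Finset.prod_ite_mem]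
  rw [h1, bernoulliWeight, bernoulliWeight, ← Finset.prod_mul_distrib]
  refine Finset.prod_le_prod (fun z _ => ?_) fun z _ => ?_
  · split_ifs <;> nlinarith
  · by_cases hz : z ∈ I
    · have := Finset.disjoint_left.1 h hz
      simp [hz, this]; nlinarith
    · simp [hz]

end Bernoulli

section TwoRounds

variable {Ω Y : Type*} [Fintype Ω] [Nonempty Ω] [Fintype Y] [DecidableEq Y]

omit [Fintype Y] [Nonempty Ω] in
theorem exists_minimal_fragment (S : Ω → Finset Y) (ω : Ω) (W : Finset Y) :
    ∃ I : Finset Y, I ⊆ S ω ∧ Disjoint I W ∧ (∃ ω', S ω' ⊆ W ∪ I) ∧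
      ∀ ω', S ω' ⊆ W ∪ I → I ⊆ S ω' := by
  obtain ⟨ω', h1, h2⟩ := Finset.exists_min_image
    (univ.filter fun ω' => S ω' ⊆ W ∪ S ω) (fun ω' => #(S ω' \ W)) ⟨ω, by simp⟩
  simp only [mem_filter, mem_univ, true_and] at h1 h2
  have hsub : S ω' \ W ⊆ S ω := by
    intro z hz
    have := h1 (mem_sdiff.1 hz).1
    grind
  refine ⟨S ω' \ W, hsub, Finset.sdiff_disjoint, ⟨ω', by simp⟩, fun ω'' h => ?_⟩
  have h3 : S ω'' \ W ⊆ S ω' \ W := by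
    intro z hz
    have := h (mem_sdiff.1 hz).1
    grind
  have h4 := Finset.eq_of_subset_of_card_le h3 (h2 ω'' (by grind))
  rw [← h4]
  exact Finset.sdiff_subset

theorem sum_large_fragments_le (S : Ω → Finset Y) (χ : Ω → Finset Y → Finset Y)
    (h1 : ∀ ω W, χ ω W ⊆ S ω) (h2 : ∀ ω W, Disjoint (χ ω W) W)
    (h3 : ∀ ω W, ∃ ω', S ω' ⊆ W ∪ χ ω W)
    (h4 : ∀ ω W ω', S ω' ⊆ W ∪ χ ω W → χ ω W ⊆ S ω')
    {p : ℝ} (hp : 0 < p) (hp1 : p ≤ 1) (t : ℕ) (B : ℝ)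
    (hB : ∀ ω, ∑ I ∈ powersetCard t (S ω), (#{ω' | I ⊆ S ω'} : ℝ) ≤ B) :
    (∑ W, bernoulliWeight p W * #{ω | #(χ ω W) = t}) * p ^ t ≤ B := by
  have he : ∀ Z : Finset Y, ∃ ω, (∃ ω', S ω' ⊆ Z) → S ω ⊆ Z := by
    intro Z
    by_cases h : ∃ ω', S ω' ⊆ Z
    · exact ⟨h.choose, fun _ => h.choose_spec⟩
    · exact ⟨Classical.arbitrary Ω, fun h' => absurd h' h⟩
  choose e he using he
  let P : Finset (Finset Y × Ω) := univ.filter fun x => #(χ x.2 x.1) = t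
  let φ : Finset Y × Ω → Finset Y × Finset Y × Ω := fun x => (x.1 ∪ χ x.2 x.1, χ x.2 x.1, x.2)
  let D : Finset (Finset Y × Finset Y × Ω) :=
    univ.filter fun x => x.2.1 ∈ powersetCard t (S (e x.1)) ∧ x.2.1 ⊆ S x.2.2
  have hinj : Set.InjOn φ P := by
    rintro ⟨W, ω⟩ _ ⟨W', ω'⟩ _ h
    simp only [φ, Prod.mk.injEq] at h
    obtain ⟨ha, hb, rfl⟩ := h
    have hW : W = (W ∪ χ ω W) \ χ ω W := by
      rw [Finset.union_sdiff_right, Finset.sdiff_eq_self_of_disjoint (h2 ω W).symm]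
    have hW' : W' = (W' ∪ χ ω W') \ χ ω W' := by
      rw [Finset.union_sdiff_right, Finset.sdiff_eq_self_of_disjoint (h2 ω W').symm]
    rw [Prod.mk.injEq]
    exact ⟨by rw [hW, hW', ha, hb], rfl⟩
  have hsub : P.image φ ⊆ D := by
    intro x hx
    obtain ⟨⟨W, ω⟩, hWω, rfl⟩ := Finset.mem_image.1 hx
    have hx : #(χ ω W) = t := by simpa [P] using hWω
    simp only [D, φ, mem_filter, mem_univ, true_and, mem_powersetCard]
    exact ⟨⟨h4 _ _ _ (he _ (h3 ω W)), hx⟩, h1 ω W⟩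
  calc _ = ∑ x ∈ P, bernoulliWeight p x.1 * p ^ t := by
        rw [Finset.sum_filter, Fintype.sum_prod_type, Finset.sum_mul]
        refine Finset.sum_congr rfl fun W _ => ?_
        dsimp only
        rw [← Finset.sum_filter, Finset.sum_const, nsmul_eq_mul]
        ring
    _ ≤ ∑ x ∈ P, bernoulliWeight p (φ x).1 := by
        refine Finset.sum_le_sum fun x hx => ?_
        have hx : #(χ x.2 x.1) = t := by simpa [P] using hx
        rw [← hx]
        exact bernoulliWeight_mul_pow_le hp.le hp1 (h2 _ _)
    _ = ∑ x ∈ P.image φ, bernoulliWeight p x.1 := by rw [Finset.sum_image hinj]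
    _ ≤ ∑ x ∈ D, bernoulliWeight p x.1 := by
        exact Finset.sum_le_sum_of_subset_of_nonneg hsub
          fun x _ _ => bernoulliWeight_nonneg hp.le hp1 _
    _ = ∑ Z, bernoulliWeight p Z * ∑ I ∈ powersetCard t (S (e Z)), (#{ω' | I ⊆ S ω'} : ℝ) := by
        rw [Finset.sum_filter, Fintype.sum_prod_type]
        refine Finset.sum_congr rfl fun Z _ => ?_
        rw [Fintype.sum_prod_type, Finset.mul_sum,
          ← Finset.sum_subset (Finset.subset_univ (powersetCard t (S (e Z))))]
        · refine Finset.sum_congr rfl fun I hI => ?_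
          simp only [hI, true_and]
          rw [← Finset.sum_filter, Finset.sum_const, nsmul_eq_mul]
          ring
        · intro I _ hI
          simp [hI]
    _ ≤ ∑ Z : Finset Y, bernoulliWeight p Z * B :=
        Finset.sum_le_sum fun Z _ =>
          mul_le_mul_of_nonneg_left (hB _) (bernoulliWeight_nonneg hp.le hp1 _)
    _ = B := by rw [← Finset.sum_mul, sum_bernoulliWeight, one_mul]

omit [Fintype Y] in
theorem inv_pow_card_le {p : ℝ} (hp : 0 < p) (hp1 : p ≤ 1) (A : Finset Y) :
    p⁻¹ ^ #A ≤ 1 + ∑ I ∈ A.powerset.erase ∅, p⁻¹ ^ #I := by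
  have h := Finset.sum_pow_mul_eq_add_pow (p⁻¹ - 1) 1 A
  have hp2 : 1 ≤ p⁻¹ := (one_le_inv₀ hp).2 hp1
  simp only [one_pow, mul_one, sub_add_cancel] at h
  rw [← h, ← Finset.add_sum_erase _ _ (Finset.empty_mem_powerset A)]
  simp only [card_empty, pow_zero]
  gcongr
  linarith

omit [Fintype Ω] [Nonempty Ω] in
/-- Second moment bound: if pairwise intersections contribute little, then the random set is
unlikely to miss all of the sets `χ ω`, `ω ∈ G`. -/
theorem second_moment_bound (χ : Ω → Finset Y) (G : Finset Ω) (hG : G.Nonempty)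
    {p : ℝ} (hp : 0 < p) (hp1 : p ≤ 1) (B : ℝ)
    (hB : ∀ ω ∈ G, ∑ I ∈ (χ ω).powerset.erase ∅,
      p⁻¹ ^ #I * #{ω' ∈ G | I ⊆ χ ω'} ≤ B) :
    (∑ V, bernoulliWeight p V * (if ∃ ω ∈ G, χ ω ⊆ V then 0 else 1)) * #G ≤ B := by
  set X : Finset Y → ℝ := fun V => ∑ ω ∈ G, p⁻¹ ^ #(χ ω) * (if χ ω ⊆ V then 1 else 0) with hX
  have hm : (0 : ℝ) < #G := by exact_mod_cast hG.card_pos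
  have hpi : ∀ k : ℕ, p⁻¹ ^ k * p ^ k = 1 := fun k => by
    rw [← mul_pow, inv_mul_cancel₀ hp.ne', one_pow]
  have hE : ∑ V, bernoulliWeight p V * X V = #G := by
    simp only [hX, Finset.mul_sum]
    rw [Finset.sum_comm]
    have : ∀ ω ∈ G, ∑ V, bernoulliWeight p V * (p⁻¹ ^ #(χ ω) * (if χ ω ⊆ V then 1 else 0)) = 1 := by
      intro ω _
      refine Eq.trans ?_ (hpi #(χ ω))
      rw [← sum_bernoulliWeight_superset p (χ ω), Finset.mul_sum]
      exact Finset.sum_congr rfl fun V _ => by ring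
    rw [Finset.sum_congr rfl this]
    simp
  have hE2 : ∑ V, bernoulliWeight p V * X V ^ 2 = ∑ ω ∈ G, ∑ ω' ∈ G, p⁻¹ ^ #(χ ω ∩ χ ω') := by
    simp only [hX, sq, Finset.sum_mul_sum]
    simp only [Finset.mul_sum]
    rw [Finset.sum_comm]
    refine Finset.sum_congr rfl fun ω _ => ?_
    rw [Finset.sum_comm]
    refine Finset.sum_congr rfl fun ω' _ => ?_
    have h1 : p⁻¹ ^ #(χ ω ∩ χ ω') = p⁻¹ ^ #(χ ω) * p⁻¹ ^ #(χ ω') * p ^ #(χ ω ∪ χ ω') := by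
      have h := hpi #(χ ω ∪ χ ω')
      have h' := Finset.card_union_add_card_inter (χ ω) (χ ω')
      rw [← pow_add, ← h', pow_add]
      linear_combination -(p⁻¹ ^ #(χ ω ∩ χ ω')) * h
    rw [h1, ← sum_bernoulliWeight_superset p (χ ω ∪ χ ω'), Finset.mul_sum]
    refine Finset.sum_congr rfl fun V _ => ?_
    have h3 : χ ω ∪ χ ω' ⊆ V ↔ χ ω ⊆ V ∧ χ ω' ⊆ V := Finset.union_subset_iff
    by_cases ha : χ ω ⊆ V <;> by_cases hb : χ ω' ⊆ V <;> simp [h3, ha, hb]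
    ring
  have hE2' : ∑ V, bernoulliWeight p V * X V ^ 2 ≤ (#G : ℝ) ^ 2 + #G * B := by
    rw [hE2]
    have h1 : ∀ ω ∈ G, ∑ ω' ∈ G, p⁻¹ ^ #(χ ω ∩ χ ω') ≤ #G + B := by
      intro ω hω
      calc ∑ ω' ∈ G, p⁻¹ ^ #(χ ω ∩ χ ω')
          ≤ ∑ ω' ∈ G, (1 + ∑ I ∈ (χ ω ∩ χ ω').powerset.erase ∅, p⁻¹ ^ #I) :=
            Finset.sum_le_sum fun ω' _ => inv_pow_card_le hp hp1 _
        _ = #G + ∑ ω' ∈ G, ∑ I ∈ (χ ω).powerset.erase ∅,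
              (if I ⊆ χ ω' then p⁻¹ ^ #I else 0) := by
            rw [Finset.sum_add_distrib]
            congr 1
            · simp
            · refine Finset.sum_congr rfl fun ω' _ => ?_
              rw [← Finset.sum_filter]
              refine Finset.sum_congr ?_ fun _ _ => rfl
              ext I
              simp only [mem_erase, mem_powerset, mem_filter, Finset.subset_inter_iff]
              tauto
        _ = #G + ∑ I ∈ (χ ω).powerset.erase ∅, p⁻¹ ^ #I * #{ω' ∈ G | I ⊆ χ ω'} := by
            rw [Finset.sum_comm]
            congr 1
            refine Finset.sum_congr rfl fun I _ => ?_
            rw [← Finset.sum_filter, Finset.sum_const, nsmul_eq_mul, mul_comm]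
        _ ≤ #G + B := by linarith [hB ω hω]
    calc _ ≤ ∑ ω ∈ G, ((#G : ℝ) + B) := Finset.sum_le_sum h1
      _ = _ := by rw [Finset.sum_const, nsmul_eq_mul]; ring
  have hvar : ∑ V, bernoulliWeight p V * (X V - #G) ^ 2 ≤ #G * B := by
    have : ∑ V, bernoulliWeight p V * (X V - #G) ^ 2 =
        ∑ V, bernoulliWeight p V * X V ^ 2 - 2 * #G * ∑ V, bernoulliWeight p V * X V +
          (#G : ℝ) ^ 2 * ∑ V : Finset Y, bernoulliWeight p V := by
      rw [Finset.mul_sum, Finset.mul_sum, ← Finset.sum_sub_distrib, ← Finset.sum_add_distrib]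
      exact Finset.sum_congr rfl fun V _ => by ring
    rw [this, hE, sum_bernoulliWeight]
    linarith
  have hlow : (∑ V, bernoulliWeight p V * (if ∃ ω ∈ G, χ ω ⊆ V then 0 else 1)) * (#G : ℝ) ^ 2 ≤
      ∑ V, bernoulliWeight p V * (X V - #G) ^ 2 := by
    rw [Finset.sum_mul]
    refine Finset.sum_le_sum fun V _ => ?_
    rw [mul_assoc]
    refine mul_le_mul_of_nonneg_left ?_ (bernoulliWeight_nonneg hp.le hp1 V)
    split_ifs with h
    · simp; positivity
    · have : X V = 0 := by
        simp only [hX]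
        refine Finset.sum_eq_zero fun ω hω => ?_
        rw [if_neg (fun h' => h ⟨ω, hω, h'⟩), mul_zero]
      rw [this]; simp
  have := hlow.trans hvar
  nlinarith

omit [Fintype Ω] [Nonempty Ω] [DecidableEq Y] in
theorem geom_sum_Ico_one_le {x : ℝ} (hx : 0 ≤ x) (hx2 : x ≤ 1 / 2) (N : ℕ) :
    ∑ t ∈ Ico 1 N, x ^ t ≤ 2 * x := by
  have h : ∀ N : ℕ, ∑ t ∈ range N, x ^ (t + 1) ≤ 2 * x - 2 * x * x ^ N := by
    intro N
    induction N with
    | zero => simp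
    | succ N ih =>
      rw [Finset.sum_range_succ]
      have : 0 ≤ x * x ^ N := by positivity
      have h2 : x ^ (N + 1) = x * x ^ N := by ring
      rw [h2]
      nlinarith
  rw [Finset.sum_Ico_eq_sum_range]
  have h1 := h (N - 1)
  have h2 : 0 ≤ 2 * x * x ^ (N - 1) := by positivity
  simp_rw [add_comm 1]
  linarith

/-- Fragmentation followed by a second moment argument: under a moment condition on the
overlaps of the sets `S ω`, the union of two independent `p`-random sets contains some `S ω`
except with probability `O(θ)`. -/
theorem two_round_bound (S : Ω → Finset Y) {p θ y b : ℝ} {ℓ : ℕ} (hp : 0 < p) (hp1 : p ≤ 1)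
    (hθ : 0 ≤ θ) (hθ1 : Real.exp 1 * θ ≤ 1 / 2) (hy : 0 ≤ y)
    (hsize : ∀ ω, y * #(S ω) ≤ ℓ) (hb : y * ℓ ≤ b)
    (hspread : ∀ ω, ∀ T ⊆ S ω, ∀ t : ℕ, ∑ I ∈ powersetCard t T, (#{ω' | I ⊆ S ω'} : ℝ) ≤
      (θ * p) ^ t * Real.exp (y * #T) * Fintype.card Ω) :
    ∑ W : Finset Y, ∑ V : Finset Y, bernoulliWeight p W * bernoulliWeight p V *
      (if ∃ ω, S ω ⊆ W ∪ V then 0 else 1) ≤ 4 * (Real.exp 1 + Real.exp b) * θ := by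
  choose χ h1 h2 h3 h4 using exists_minimal_fragment S
  have hN : (0 : ℝ) < Fintype.card Ω := by exact_mod_cast Fintype.card_pos
  have he1 : 1 ≤ Real.exp 1 := Real.one_le_exp zero_le_one
  have hθ2 : θ ≤ 1 / 2 := by nlinarith
  set N : ℕ := Fintype.card Y + 1
  have hcard : ∀ A : Finset Y, #A < N := fun A => Nat.lt_succ_of_le (Finset.card_le_univ A)
  set Bad : Finset Y → ℕ := fun W => #{ω | ℓ < #(χ ω W)}
  have hbad : ∑ W, bernoulliWeight p W * Bad W ≤ 2 * (Real.exp 1 * θ) * Fintype.card Ω := by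
    have hstep : ∀ t, ℓ < t → ∑ W, bernoulliWeight p W * #{ω | #(χ ω W) = t} ≤
        (Real.exp 1 * θ) ^ t * Fintype.card Ω := by
      intro t ht
      have h := sum_large_fragments_le S χ h1 h2 h3 h4 hp hp1 t
        ((θ * p) ^ t * Real.exp ℓ * Fintype.card Ω) (fun ω => (hspread ω _ subset_rfl t).trans (by
          have := hsize ω
          gcongr))
      have hpt : 0 < p ^ t := by positivity
      rw [mul_pow] at h
      have h5 : ∑ W, bernoulliWeight p W * #{ω | #(χ ω W) = t} ≤
          θ ^ t * Real.exp ℓ * Fintype.card Ω := by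
        refine le_of_mul_le_mul_right (h.trans_eq ?_) hpt
        ring
      refine h5.trans ?_
      have h6 : Real.exp ℓ ≤ Real.exp 1 ^ t := by
        rw [← Real.exp_nat_mul, mul_one]
        exact Real.exp_le_exp.2 (by exact_mod_cast ht.le)
      rw [mul_pow, mul_comm (Real.exp 1 ^ t)]
      gcongr
    have hsplit : ∀ W, (Bad W : ℝ) ≤ ∑ t ∈ Ico (ℓ + 1) N, (#{ω | #(χ ω W) = t} : ℝ) := by
      intro W
      have : (univ.filter fun ω => ℓ < #(χ ω W)) ⊆
          (Ico (ℓ + 1) N).biUnion fun t => univ.filter fun ω => #(χ ω W) = t := by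
        intro ω hω
        simp only [mem_filter, mem_univ, true_and] at hω
        simp [hω, hcard]
      exact_mod_cast (Finset.card_le_card this).trans Finset.card_biUnion_le
    calc ∑ W, bernoulliWeight p W * Bad W
        ≤ ∑ W, bernoulliWeight p W * ∑ t ∈ Ico (ℓ + 1) N, (#{ω | #(χ ω W) = t} : ℝ) :=
          Finset.sum_le_sum fun W _ =>
            mul_le_mul_of_nonneg_left (hsplit W) (bernoulliWeight_nonneg hp.le hp1 W)
      _ = ∑ t ∈ Ico (ℓ + 1) N, ∑ W, bernoulliWeight p W * (#{ω | #(χ ω W) = t} : ℝ) := by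
          simp only [Finset.mul_sum]
          rw [Finset.sum_comm]
      _ ≤ ∑ t ∈ Ico (ℓ + 1) N, (Real.exp 1 * θ) ^ t * Fintype.card Ω :=
          Finset.sum_le_sum fun t ht => hstep t (by simp at ht; omega)
      _ = (∑ t ∈ Ico (ℓ + 1) N, (Real.exp 1 * θ) ^ t) * Fintype.card Ω := by
          rw [Finset.sum_mul]
      _ ≤ (∑ t ∈ Ico 1 N, (Real.exp 1 * θ) ^ t) * Fintype.card Ω := by
          gcongr
          omega
      _ ≤ _ := by
          gcongr
          exact geom_sum_Ico_one_le (by positivity) hθ1 N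
  have hround : ∀ W, (∑ V : Finset Y, bernoulliWeight p V *
      (if ∃ ω, S ω ⊆ W ∪ V then 0 else 1)) ≤
        2 * (Bad W / Fintype.card Ω) + 4 * Real.exp b * θ := by
    intro W
    set G : Finset Ω := univ.filter fun ω => #(χ ω W) ≤ ℓ with hG
    have hGB : (#G : ℝ) + Bad W = Fintype.card Ω := by
      have := Finset.card_filter_add_card_filter_not (s := (univ : Finset Ω))
        (fun ω => #(χ ω W) ≤ ℓ)
      simp only [not_le] at this
      exact_mod_cast this
    rcases le_or_gt (Fintype.card Ω : ℝ) (2 * Bad W) with hcase | hcase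
    · have : (∑ V : Finset Y, bernoulliWeight p V *
          (if ∃ ω, S ω ⊆ W ∪ V then 0 else 1)) ≤ 1 := by
        refine le_of_le_of_eq ?_ (sum_bernoulliWeight (Y := Y) p)
        refine Finset.sum_le_sum fun V _ => ?_
        have := bernoulliWeight_nonneg hp.le hp1 V
        split_ifs <;> simp [this]
      have h5 : 1 ≤ 2 * (Bad W / Fintype.card Ω : ℝ) := by
        rw [← mul_div_assoc, le_div_iff₀ hN]; linarith
      have : 0 ≤ 4 * Real.exp b * θ := by positivity
      linarith
    · have hGpos : (0 : ℝ) < #G := by linarith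
      have hGne : G.Nonempty := Finset.card_pos.1 (by exact_mod_cast hGpos)
      have hsm := second_moment_bound (fun ω => χ ω W) G hGne hp hp1
        (2 * θ * Real.exp b * Fintype.card Ω) (by
        intro ω hω
        have hω' : #(χ ω W) ≤ ℓ := by simpa [hG] using hω
        calc ∑ I ∈ (χ ω W).powerset.erase ∅, p⁻¹ ^ #I * (#{ω' ∈ G | I ⊆ χ ω' W} : ℝ)
            ≤ ∑ I ∈ (χ ω W).powerset.erase ∅, p⁻¹ ^ #I * (#{ω' | I ⊆ S ω'} : ℝ) := by
              gcongr with I _ ω'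
              intro ω' hω'
              simp only [mem_filter] at hω' ⊢
              exact ⟨mem_univ _, hω'.2.trans (h1 _ _)⟩
          _ = ∑ t ∈ Ico 1 N, ∑ I ∈ powersetCard t (χ ω W),
                p⁻¹ ^ #I * (#{ω' | I ⊆ S ω'} : ℝ) := by
              rw [← Finset.sum_biUnion]
              · refine Finset.sum_congr ?_ fun _ _ => rfl
                ext I
                simp only [mem_erase, mem_powerset, mem_biUnion, mem_Ico, mem_powersetCard]
                constructor
                · rintro ⟨hI, hI2⟩
                  exact ⟨#I, ⟨Finset.card_pos.2 (Finset.nonempty_iff_ne_empty.2 hI), hcard I⟩,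
                    hI2, rfl⟩
                · rintro ⟨t, ⟨ht, _⟩, hI, rfl⟩
                  exact ⟨Finset.nonempty_iff_ne_empty.1 (Finset.card_pos.1 ht), hI⟩
              · intro s _ t _ hst
                exact Finset.pairwise_disjoint_powersetCard _ hst
          _ ≤ ∑ t ∈ Ico 1 N, θ ^ t * (Real.exp b * Fintype.card Ω) := by
              refine Finset.sum_le_sum fun t _ => ?_
              have h5 := hspread ω (χ ω W) (h1 ω W) t
              have h6 : Real.exp (y * #(χ ω W)) ≤ Real.exp b := by
                refine Real.exp_le_exp.2 (le_trans ?_ hb)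
                gcongr
              calc _ = p⁻¹ ^ t * ∑ I ∈ powersetCard t (χ ω W), (#{ω' | I ⊆ S ω'} : ℝ) := by
                    rw [Finset.mul_sum]
                    refine Finset.sum_congr rfl fun I hI => ?_
                    rw [(mem_powersetCard.1 hI).2]
                _ ≤ p⁻¹ ^ t * ((θ * p) ^ t * Real.exp b * Fintype.card Ω) := by
                    gcongr
                    exact h5.trans (by gcongr)
                _ = _ := by
                    rw [mul_pow, inv_pow]
                    field_simp
          _ = (∑ t ∈ Ico 1 N, θ ^ t) * (Real.exp b * Fintype.card Ω) := by
              rw [Finset.sum_mul]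
          _ ≤ 2 * θ * (Real.exp b * Fintype.card Ω) := by
              gcongr
              exact geom_sum_Ico_one_le hθ hθ2 N
          _ = _ := by ring)
      have hle : (∑ V : Finset Y, bernoulliWeight p V *
          (if ∃ ω, S ω ⊆ W ∪ V then 0 else 1)) ≤
          ∑ V, bernoulliWeight p V * (if ∃ ω ∈ G, χ ω W ⊆ V then 0 else 1) := by
        refine Finset.sum_le_sum fun V _ => ?_
        refine mul_le_mul_of_nonneg_left ?_ (bernoulliWeight_nonneg hp.le hp1 V)
        by_cases hV : ∃ ω ∈ G, χ ω W ⊆ V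
        · obtain ⟨ω, _, hω⟩ := hV
          obtain ⟨ω', hω'⟩ := h3 ω W
          have : ∃ ω, S ω ⊆ W ∪ V := ⟨ω', hω'.trans (Finset.union_subset_union_right hω)⟩
          rw [if_pos this]
          split_ifs <;> norm_num
        · rw [if_neg hV]
          split_ifs <;> norm_num
      refine hle.trans ?_
      have h7 : ∑ V, bernoulliWeight p V * (if ∃ ω ∈ G, χ ω W ⊆ V then 0 else 1) ≤
          4 * Real.exp b * θ := by
        refine le_of_mul_le_mul_right (hsm.trans ?_) hGpos
        have : 0 ≤ θ * Real.exp b := by positivity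
        nlinarith
      have : (0 : ℝ) ≤ 2 * (Bad W / Fintype.card Ω) := by positivity
      linarith
  calc _ = ∑ W : Finset Y, bernoulliWeight p W * ∑ V : Finset Y, bernoulliWeight p V *
      (if ∃ ω, S ω ⊆ W ∪ V then 0 else 1) := by
        simp only [Finset.mul_sum, mul_assoc]
    _ ≤ ∑ W : Finset Y, bernoulliWeight p W *
        (2 * (Bad W / Fintype.card Ω) + 4 * Real.exp b * θ) :=
        Finset.sum_le_sum fun W _ =>
          mul_le_mul_of_nonneg_left (hround W) (bernoulliWeight_nonneg hp.le hp1 W)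
    _ = 2 / Fintype.card Ω * ∑ W, bernoulliWeight p W * Bad W +
        4 * Real.exp b * θ * ∑ W : Finset Y, bernoulliWeight p W := by
        rw [Finset.mul_sum, Finset.mul_sum, ← Finset.sum_add_distrib]
        exact Finset.sum_congr rfl fun W _ => by ring
    _ ≤ 2 / Fintype.card Ω * (2 * (Real.exp 1 * θ) * Fintype.card Ω) +
        4 * Real.exp b * θ * 1 := by
        rw [sum_bernoulliWeight]
        gcongr
    _ = _ := by field_simp; ring

end TwoRounds

section Embeddings

theorem pow_le_exp_mul_descFactorial {q t : ℕ} (h : t ≤ q) :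
    (q : ℝ) ^ t ≤ Real.exp t * q.descFactorial t := by
  have h1 : (q : ℝ) ^ t * t.factorial ≤ (t : ℝ) ^ t * q.descFactorial t := by
    have : q ^ t * t.descFactorial t ≤ t ^ t * q.descFactorial t := by
      have hc : ∀ c : ℕ, c ^ t = ∏ _i ∈ range t, c := fun c => by simp
      rw [Nat.descFactorial_eq_prod_range, Nat.descFactorial_eq_prod_range, hc q, hc t,
        ← Finset.prod_mul_distrib, ← Finset.prod_mul_distrib]
      refine Finset.prod_le_prod' fun i hi => ?_
      have hi := Finset.mem_range.1 hi
      obtain ⟨a, rfl⟩ := Nat.exists_eq_add_of_lt hi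
      obtain ⟨b, rfl⟩ := Nat.exists_eq_add_of_le h
      have e1 : i + a + 1 - i = a + 1 := by omega
      have e2 : i + a + 1 + b - i = a + 1 + b := by omega
      rw [e1, e2]
      nlinarith [Nat.zero_le (i * b)]
    rw [Nat.descFactorial_self] at this
    exact_mod_cast this
  have h2 : (t : ℝ) ^ t ≤ Real.exp t * t.factorial := by
    have := Real.pow_div_factorial_le_exp (t : ℝ) (by positivity) t
    rwa [div_le_iff₀ (by positivity)] at this
  have h3 : (0 : ℝ) < t.factorial := by positivity
  refine le_of_mul_le_mul_right (h1.trans ?_) h3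
  calc (t : ℝ) ^ t * q.descFactorial t ≤ Real.exp t * t.factorial * q.descFactorial t := by gcongr
    _ = _ := by ring

variable {α β : Type*} [Fintype α] [Fintype β] [DecidableEq α] [DecidableEq β]

theorem card_embedding_extending_le (U : Finset α) (y : α → β) :
    #{f : α ↪ β | ∀ a ∈ U, f a = y a} ≤
      (Fintype.card β - #U).descFactorial (Fintype.card α - #U) := by
  rcases (univ.filter fun f : α ↪ β => ∀ a ∈ U, f a = y a).eq_empty_or_nonempty with h0 | ⟨f₀, hf₀⟩
  · rw [h0]; simp
  have hf₀ : ∀ a ∈ U, f₀ a = y a := by simpa using hf₀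
  have hy : Set.InjOn y U := fun a ha b hb hab => f₀.injective (by rw [hf₀ a ha, hf₀ b hb, hab])
  have hcard : (Fintype.card β - #U).descFactorial (Fintype.card α - #U) =
      Fintype.card ({a // a ∈ Uᶜ} ↪ {b // b ∈ (U.image y)ᶜ}) := by
    rw [Fintype.card_embedding_eq, Fintype.card_coe, Fintype.card_coe, Finset.card_compl,
      Finset.card_compl, Finset.card_image_of_injOn hy]
  rw [hcard, ← Fintype.card_coe]
  have hmem : ∀ f : {f // f ∈ univ.filter fun f : α ↪ β => ∀ a ∈ U, f a = y a},
      ∀ a ∈ U, f.1 a = y a := fun f => (Finset.mem_filter.1 f.2).2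
  refine Fintype.card_le_of_injective (fun f =>
    ⟨fun a => ⟨f.1 a, ?_⟩, fun a b hab => Subtype.ext (f.1.injective (by simpa using hab))⟩) ?_
  · rw [Finset.mem_compl, Finset.mem_image]
    rintro ⟨b, hb, hba⟩
    rw [← hmem f b hb] at hba
    have := f.1.injective hba
    exact Finset.mem_compl.1 a.2 (this ▸ hb)
  · intro f g hfg
    refine Subtype.ext (Function.Embedding.ext fun a => ?_)
    by_cases ha : a ∈ U
    · rw [hmem f a ha, hmem g a ha]
    · have := DFunLike.congr_fun hfg ⟨a, Finset.mem_compl.2 ha⟩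
      exact congrArg Subtype.val this

/-- A uniformly random injection takes prescribed values on `U` with probability at most
`(e / |β|) ^ |U|`. -/
theorem card_embedding_extending_le_mul (hαβ : Fintype.card α ≤ Fintype.card β)
    (U : Finset α) (y : α → β) :
    (#{f : α ↪ β | ∀ a ∈ U, f a = y a} : ℝ) ≤
      (Real.exp 1 / Fintype.card β) ^ #U * Fintype.card (α ↪ β) := by
  have hU : #U ≤ Fintype.card α := Finset.card_le_univ U
  have h1 : (#{f : α ↪ β | ∀ a ∈ U, f a = y a} : ℝ) ≤
      ((Fintype.card β - #U).descFactorial (Fintype.card α - #U) : ℕ) := by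
    exact_mod_cast card_embedding_extending_le U y
  refine h1.trans ?_
  rw [Fintype.card_embedding_eq, ← Nat.descFactorial_mul_descFactorial hU, div_pow, Nat.cast_mul]
  rcases Nat.eq_zero_or_pos (Fintype.card β) with h0 | h0
  · have : #U = 0 := by omega
    simp [this]
  have h2 := pow_le_exp_mul_descFactorial (hU.trans hαβ)
  have h3 : (0 : ℝ) < (Fintype.card β : ℝ) ^ #U := by positivity
  rw [← Real.exp_nat_mul, mul_one, div_mul_eq_mul_div, le_div_iff₀ h3]
  calc _ ≤ ((Fintype.card β - #U).descFactorial (Fintype.card α - #U) : ℝ) *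
        (Real.exp #U * (Fintype.card β).descFactorial #U) := by gcongr
    _ = _ := by ring

end Embeddings

section Comparison

variable {X Q Ω α β : Type*} [Fintype X] [DecidableEq X] [Fintype Q] [DecidableEq Q]
  [Fintype α] [Fintype β]

omit [Fintype X] [DecidableEq X] [Fintype Q] in
theorem sum_pushforward [DecidableEq β] (u : α → ℝ) (ρ : α → β) (g : β → ℝ) :
    ∑ r, (∑ a with ρ a = r, u a) * g r = ∑ a, u a * g (ρ a) := by
  rw [← Finset.sum_fiberwise univ ρ]
  refine Finset.sum_congr rfl fun r _ => ?_
  rw [Finset.sum_mul]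
  refine Finset.sum_congr rfl fun a ha => ?_
  rw [(Finset.mem_filter.1 ha).2]

theorem sum_prod_pushforward [DecidableEq β] (u : X → α → ℝ) (ρ : α → β) (g : (X → β) → ℝ) :
    ∑ f : X → α, (∏ x, u x (f x)) * g (fun x => ρ (f x)) =
      ∑ R : X → β, (∏ x, ∑ a with ρ a = R x, u x a) * g R := by
  rw [← Finset.sum_fiberwise univ (fun (f : X → α) x => ρ (f x))]
  refine Finset.sum_congr rfl fun R _ => ?_
  rw [Finset.prod_univ_sum, Finset.sum_mul]
  refine Finset.sum_congr ?_ fun f hf => ?_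
  · ext f
    simp [Fintype.mem_piFinset, funext_iff]
  · have : (fun x => ρ (f x)) = R := by
      funext x
      simpa using Fintype.mem_piFinset.1 hf x
    rw [this]

omit [Fintype X] [Fintype Q] [DecidableEq Q] in
theorem exists_forall_mem_update_iff (S : Ω → Finset (X × Q))
    (hS : ∀ ω x c c', (x, c) ∈ S ω → (x, c') ∈ S ω → c = c') (R : X → Finset Q) (x₀ : X)
    (hR : ¬∃ ω, ∀ z ∈ S ω, z.1 ≠ x₀ ∧ z.2 ∈ R z.1) (r : Finset Q) :
    (∃ ω, ∀ z ∈ S ω, z.2 ∈ Function.update R x₀ r z.1) ↔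
      ∃ c, (∃ ω, (x₀, c) ∈ S ω ∧ ∀ z ∈ S ω, z.1 ≠ x₀ → z.2 ∈ R z.1) ∧ c ∈ r := by
  constructor
  · rintro ⟨ω, hω⟩
    have h1 : ∀ z ∈ S ω, z.1 ≠ x₀ → z.2 ∈ R z.1 := fun z hz hzx => by
      simpa [Function.update_of_ne hzx] using hω z hz
    have h2 : ∃ z ∈ S ω, z.1 = x₀ := by
      by_contra! h
      exact hR ⟨ω, fun z hz => ⟨h z hz, h1 z hz (h z hz)⟩⟩
    obtain ⟨⟨x, c⟩, hz, rfl⟩ := h2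
    exact ⟨c, ⟨ω, hz, h1⟩, by simpa using hω _ hz⟩
  · rintro ⟨c, ⟨ω, hc, hω⟩, hcr⟩
    refine ⟨ω, fun z hz => ?_⟩
    by_cases hzx : z.1 = x₀
    · obtain ⟨x, c'⟩ := z
      obtain rfl : x = x₀ := hzx
      rw [hS ω x c' c hz hc]
      simpa using hcr
    · simpa [Function.update_of_ne hzx] using hω z hz hzx

theorem sum_prod_update_le (S : Ω → Finset (X × Q))
    (hS : ∀ ω x c c', (x, c) ∈ S ω → (x, c') ∈ S ω → c = c') (w : X → Finset Q → ℝ)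
    (hw : ∀ x r, 0 ≤ w x r) (x₀ : X) (u v : Finset Q → ℝ) (hu : ∑ r, u r = 1)
    (hv : ∑ r, v r = 1)
    (huv : ∀ A : Finset Q, (∀ c ∈ A, ∃ ω, (x₀, c) ∈ S ω) →
      ∑ r, u r * (if ∃ c ∈ A, c ∈ r then 1 else 0) ≤
        ∑ r, v r * (if ∃ c ∈ A, c ∈ r then 1 else 0)) :
    ∑ R : X → Finset Q, (∏ x, Function.update w x₀ u x (R x)) *
        (if ∃ ω, ∀ z ∈ S ω, z.2 ∈ R z.1 then 1 else 0) ≤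
      ∑ R : X → Finset Q, (∏ x, Function.update w x₀ v x (R x)) *
        (if ∃ ω, ∀ z ∈ S ω, z.2 ∈ R z.1 then 1 else 0) := by
  have key : ∀ u : Finset Q → ℝ, ∑ R : X → Finset Q, (∏ x, Function.update w x₀ u x (R x)) *
      (if ∃ ω, ∀ z ∈ S ω, z.2 ∈ R z.1 then 1 else 0) =
      ∑ R' : {x // x ≠ x₀} → Finset Q, (∏ x, w x.1 (R' x)) *
        ∑ r, u r * (if ∃ ω, ∀ z ∈ S ω,
          z.2 ∈ (Equiv.funSplitAt x₀ (Finset Q)).symm (r, R') z.1 then 1 else 0) := by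
    intro u
    rw [← (Equiv.funSplitAt x₀ (Finset Q)).symm.sum_comp, Fintype.sum_prod_type, Finset.sum_comm]
    refine Finset.sum_congr rfl fun R' _ => ?_
    rw [Finset.mul_sum]
    refine Finset.sum_congr rfl fun r _ => ?_
    rw [Fintype.prod_eq_mul_prod_subtype_ne _ x₀]
    have h1 : ∀ x : {x // x ≠ x₀}, Function.update w x₀ u x.1
        ((Equiv.funSplitAt x₀ (Finset Q)).symm (r, R') x.1) = w x.1 (R' x) := by
      intro x
      rw [Function.update_of_ne x.2]
      simp [x.2]
    have h2 : (Equiv.funSplitAt x₀ (Finset Q)).symm (r, R') x₀ = r := by simp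
    rw [Finset.prod_congr rfl fun x _ => h1 x, Function.update_self, h2]
    ring
  rw [key, key]
  refine Finset.sum_le_sum fun R' _ => mul_le_mul_of_nonneg_left ?_
    (Finset.prod_nonneg fun x _ => hw _ _)
  obtain ⟨R, hupd⟩ : ∃ R : X → Finset Q, ∀ r, (Equiv.funSplitAt x₀ (Finset Q)).symm (r, R') =
      Function.update R x₀ r := by
    refine ⟨(Equiv.funSplitAt x₀ (Finset Q)).symm (∅, R'), fun r => ?_⟩
    funext x
    by_cases hx : x = x₀
    · subst hx; simp
    · rw [Function.update_of_ne hx]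
      simp [hx]
  simp_rw [hupd]
  by_cases hR : ∃ ω, ∀ z ∈ S ω, z.1 ≠ x₀ ∧ z.2 ∈ R z.1
  · have : ∀ r, ∃ ω, ∀ z ∈ S ω, z.2 ∈ Function.update R x₀ r z.1 := by
      intro r
      obtain ⟨ω, hω⟩ := hR
      refine ⟨ω, fun z hz => ?_⟩
      rw [Function.update_of_ne (hω z hz).1]
      exact (hω z hz).2
    simp only [this, if_true, mul_one, hu, hv, le_refl]
  · have h := huv (univ.filter fun c =>
      ∃ ω, (x₀, c) ∈ S ω ∧ ∀ z ∈ S ω, z.1 ≠ x₀ → z.2 ∈ R z.1) (by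
        intro c hc
        obtain ⟨ω, hω, _⟩ := (Finset.mem_filter.1 hc).2
        exact ⟨ω, hω⟩)
    simp only [mem_filter, mem_univ, true_and] at h
    simpa only [exists_forall_mem_update_iff S hS R x₀ hR] using h

/-- Replacing the random color sets one coordinate at a time can only increase the probability
of containing some `S ω`, if each replacement increases all hitting probabilities. -/
theorem sum_prod_le_of_hitting_le (S : Ω → Finset (X × Q))
    (hS : ∀ ω x c c', (x, c) ∈ S ω → (x, c') ∈ S ω → c = c') (u v : X → Finset Q → ℝ)
    (hu : ∀ x r, 0 ≤ u x r) (hv : ∀ x r, 0 ≤ v x r) (hu1 : ∀ x, ∑ r, u x r = 1)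
    (hv1 : ∀ x, ∑ r, v x r = 1)
    (huv : ∀ x, ∀ A : Finset Q, (∀ c ∈ A, ∃ ω, (x, c) ∈ S ω) →
      ∑ r, u x r * (if ∃ c ∈ A, c ∈ r then 1 else 0) ≤
        ∑ r, v x r * (if ∃ c ∈ A, c ∈ r then 1 else 0)) :
    ∑ R : X → Finset Q, (∏ x, u x (R x)) *
        (if ∃ ω, ∀ z ∈ S ω, z.2 ∈ R z.1 then 1 else 0) ≤
      ∑ R : X → Finset Q, (∏ x, v x (R x)) *
        (if ∃ ω, ∀ z ∈ S ω, z.2 ∈ R z.1 then 1 else 0) := by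
  have h : ∀ D : Finset X, ∑ R : X → Finset Q, (∏ x, u x (R x)) *
        (if ∃ ω, ∀ z ∈ S ω, z.2 ∈ R z.1 then 1 else 0) ≤
      ∑ R : X → Finset Q, (∏ x, (if x ∈ D then v x else u x) (R x)) *
        (if ∃ ω, ∀ z ∈ S ω, z.2 ∈ R z.1 then 1 else 0) := by
    intro D
    induction D using Finset.induction_on with
    | empty => simp
    | insert x₀ D hx₀ ih =>
      refine ih.trans ?_
      set w : X → Finset Q → ℝ := fun x => if x ∈ D then v x else u x
      have h1 : (fun x => if x ∈ insert x₀ D then v x else u x) =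
          Function.update w x₀ (v x₀) := by
        funext x
        by_cases hx : x = x₀
        · subst hx; simp
        · simp [hx, w]
      have h2 : w = Function.update w x₀ (u x₀) := by
        rw [eq_comm, Function.update_eq_self_iff]
        simp [w, hx₀]
      have h3 := sum_prod_update_le S hS w (fun x r => by
        simp only [w]; split_ifs <;> simp [hu, hv]) x₀ (u x₀) (v x₀) (hu1 x₀) (hv1 x₀) (huv x₀)
      rw [← h2, ← h1] at h3
      exact h3
  simpa using h univ

theorem sum_prod_le_of_hitting_le' (S : Ω → Finset (X × Q))
    (hS : ∀ ω x c c', (x, c) ∈ S ω → (x, c') ∈ S ω → c = c') (u : X → α → ℝ) (v : X → β → ℝ)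
    (ρ : α → Finset Q) (τ : β → Finset Q)
    (hu : ∀ x a, 0 ≤ u x a) (hv : ∀ x b, 0 ≤ v x b) (hu1 : ∀ x, ∑ a, u x a = 1)
    (hv1 : ∀ x, ∑ b, v x b = 1)
    (huv : ∀ x, ∀ A : Finset Q, (∀ c ∈ A, ∃ ω, (x, c) ∈ S ω) →
      ∑ a, u x a * (if ∃ c ∈ A, c ∈ ρ a then 1 else 0) ≤
        ∑ b, v x b * (if ∃ c ∈ A, c ∈ τ b then 1 else 0)) :
    ∑ f : X → α, (∏ x, u x (f x)) *
        (if ∃ ω, ∀ z ∈ S ω, z.2 ∈ ρ (f z.1) then 1 else 0) ≤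
      ∑ f : X → β, (∏ x, v x (f x)) *
        (if ∃ ω, ∀ z ∈ S ω, z.2 ∈ τ (f z.1) then 1 else 0) := by
  have e1 := sum_prod_pushforward u ρ
    (fun R : X → Finset Q => if ∃ ω, ∀ z ∈ S ω, z.2 ∈ R z.1 then 1 else 0)
  have e2 := sum_prod_pushforward v τ
    (fun R : X → Finset Q => if ∃ ω, ∀ z ∈ S ω, z.2 ∈ R z.1 then 1 else 0)
  rw [e1, e2]
  refine sum_prod_le_of_hitting_le S hS (fun x r => ∑ a with ρ a = r, u x a)
    (fun x r => ∑ b with τ b = r, v x b)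
    (fun x r => Finset.sum_nonneg fun a _ => hu x a)
    (fun x r => Finset.sum_nonneg fun a _ => hv x a) (fun x => ?_) (fun x => ?_) fun x A hA => ?_
  · rw [Finset.sum_fiberwise, hu1]
  · rw [Finset.sum_fiberwise, hv1]
  · rw [sum_pushforward, sum_pushforward]
    exact huv x A hA

end Comparison

section ColoredComparison

variable {X Q Ω : Type*} [Fintype X] [DecidableEq X] [Fintype Q] [DecidableEq Q]

/-- A set of colored elements of `X` is the same as a set of colors for each element of `X`. -/
def sliceEquiv (X Q : Type*) [Fintype X] [DecidableEq X] [Fintype Q] [DecidableEq Q] :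
    Finset (X × Q) ≃ (X → Finset Q) where
  toFun W x := univ.filter fun c => (x, c) ∈ W
  invFun R := univ.filter fun z => z.2 ∈ R z.1
  left_inv W := by ext; simp
  right_inv R := by funext x; ext; simp

theorem mem_sliceEquiv (W : Finset (X × Q)) (x : X) (c : Q) :
    c ∈ sliceEquiv X Q W x ↔ (x, c) ∈ W := by
  simp [sliceEquiv]

theorem bernoulliWeight_eq_prod_slice (p : ℝ) (W : Finset (X × Q)) :
    bernoulliWeight p W = ∏ x, bernoulliWeight p (sliceEquiv X Q W x) := by
  simp only [bernoulliWeight, mem_sliceEquiv]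
  rw [Fintype.prod_prod_type]

theorem sum_two_round_eq (S : Ω → Finset (X × Q)) (p : ℝ) :
    ∑ W, ∑ V, bernoulliWeight p W * bernoulliWeight p V *
        (if ∃ ω, S ω ⊆ W ∪ V then 1 else 0) =
      ∑ f : X → Finset Q × Finset Q,
        (∏ x, bernoulliWeight p (f x).1 * bernoulliWeight p (f x).2) *
          (if ∃ ω, ∀ z ∈ S ω, z.2 ∈ (f z.1).1 ∪ (f z.1).2 then 1 else 0) := by
  rw [← Fintype.sum_prod_type']
  refine Fintype.sum_equiv (((sliceEquiv X Q).prodCongr (sliceEquiv X Q)).trans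
    (Equiv.arrowProdEquivProdArrow X _ _).symm) _ _ fun WV => ?_
  rw [bernoulliWeight_eq_prod_slice, bernoulliWeight_eq_prod_slice, ← Finset.prod_mul_distrib]
  congr 1
  refine if_congr ?_ rfl rfl
  refine exists_congr fun ω => forall₂_congr fun z _ => ?_
  simp [Equiv.arrowProdEquivProdArrow, mem_sliceEquiv]

omit [DecidableEq Q] in
theorem sum_random_coloring_eq (P : Finset X) (p : ℝ) (T : Finset X → (X → Q) → ℝ) :
    ∑ f : X → Bool × Q, (∏ x, (if (f x).1 then (if x ∈ P then p else 0)
        else 1 - (if x ∈ P then p else 0)) * (Fintype.card Q : ℝ)⁻¹) *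
        T (univ.filter fun x => (f x).1 = true) (fun x => (f x).2) =
      ∑ E ∈ P.powerset, ∑ c : X → Q, p ^ #E * (1 - p) ^ (#P - #E) *
        ((Fintype.card Q : ℝ) ^ Fintype.card X)⁻¹ * T E c := by
  have h1 : ∑ E ∈ P.powerset, ∑ c : X → Q, p ^ #E * (1 - p) ^ (#P - #E) *
        ((Fintype.card Q : ℝ) ^ Fintype.card X)⁻¹ * T E c =
      ∑ E : Finset X, ∑ c : X → Q, (∏ x, (if x ∈ E then (if x ∈ P then p else 0)
        else 1 - (if x ∈ P then p else 0))) *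
        ((Fintype.card Q : ℝ) ^ Fintype.card X)⁻¹ * T E c := by
    rw [← Finset.sum_subset (Finset.subset_univ P.powerset)]
    · refine Finset.sum_congr rfl fun E hE => Finset.sum_congr rfl fun c _ => ?_
      have hE := Finset.mem_powerset.1 hE
      congr 2
      rw [Finset.prod_ite]
      have e1 : (univ.filter fun x => x ∈ E) = E := by ext; simp
      rw [e1, Finset.prod_congr rfl (g := fun _ => p) (fun x hx => if_pos (hE hx)),
        Finset.prod_const]
      congr 1
      rw [← Finset.card_sdiff_of_subset hE, ← Finset.prod_const]
      have h2 : ∏ x ∈ P \ E, (1 - p) = ∏ x ∈ P \ E, (1 - (if x ∈ P then p else 0)) :=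
        Finset.prod_congr rfl fun x hx => by rw [if_pos (Finset.mem_sdiff.1 hx).1]
      rw [h2]
      refine Finset.prod_subset ?_ ?_
      · intro x hx
        simpa using (Finset.mem_sdiff.1 hx).2
      · intro x hx hx'
        have : x ∉ P := fun h => hx' (Finset.mem_sdiff.2 ⟨h, (Finset.mem_filter.1 hx).2⟩)
        simp [this]
    · intro E _ hE
      refine Finset.sum_eq_zero fun c _ => ?_
      obtain ⟨x, hxE, hxP⟩ := Finset.not_subset.1 (fun h => hE (Finset.mem_powerset.2 h))
      rw [Finset.prod_eq_zero (Finset.mem_univ x) (by simp [hxE, hxP])]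
      simp
  rw [h1, ← Fintype.sum_prod_type']
  let e : (X → Bool) ≃ Finset X :=
    { toFun := fun f => univ.filter fun x => f x = true
      invFun := fun E x => decide (x ∈ E)
      left_inv := fun f => by funext x; simp
      right_inv := fun E => by ext; simp }
  refine Fintype.sum_equiv ((Equiv.arrowProdEquivProdArrow X _ _).trans
    (e.prodCongr (Equiv.refl _))) _ _ fun f => ?_
  rw [Finset.prod_mul_distrib, Finset.prod_const, inv_pow, Finset.card_univ]
  simp [e, Equiv.arrowProdEquivProdArrow]

/-- Containing one of the rainbow structures `S ω` in the union of two sparse random subsets of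
`P × Q` is at most as likely as in a randomly colored random subset of `P`. -/
theorem two_round_le_random_coloring [Nonempty Q] (P : Finset X) (S : Ω → Finset (X × Q))
    (hS : ∀ ω x c c', (x, c) ∈ S ω → (x, c') ∈ S ω → c = c')
    (hP : ∀ ω, ∀ z ∈ S ω, z.1 ∈ P) {p : ℝ} (hp : 0 ≤ p) (hp1 : p ≤ 1) :
    ∑ W, ∑ V, bernoulliWeight (p / (2 * Fintype.card Q)) W *
        bernoulliWeight (p / (2 * Fintype.card Q)) V *
        (if ∃ ω, S ω ⊆ W ∪ V then 1 else 0) ≤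
      ∑ E ∈ P.powerset, ∑ c : X → Q, p ^ #E * (1 - p) ^ (#P - #E) *
        ((Fintype.card Q : ℝ) ^ Fintype.card X)⁻¹ *
        (if ∃ ω, ∀ z ∈ S ω, z.1 ∈ E ∧ c z.1 = z.2 then 1 else 0) := by
  have hq : (1 : ℝ) ≤ Fintype.card Q := by exact_mod_cast Fintype.card_pos
  have hq0 : (0 : ℝ) < Fintype.card Q := by linarith
  set p₁ := p / (2 * Fintype.card Q) with hp₁
  have hp₁0 : 0 ≤ p₁ := by positivity
  have hp₁1 : p₁ ≤ 1 := by
    rw [hp₁, div_le_one (by positivity)]; linarith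
  rw [sum_two_round_eq, ← sum_random_coloring_eq P p
    (fun E c => if ∃ ω, ∀ z ∈ S ω, z.1 ∈ E ∧ c z.1 = z.2 then 1 else 0)]
  have key := sum_prod_le_of_hitting_le' S hS
    (fun _ (a : Finset Q × Finset Q) => bernoulliWeight p₁ a.1 * bernoulliWeight p₁ a.2)
    (fun x (b : Bool × Q) => (if b.1 then (if x ∈ P then p else 0)
        else 1 - (if x ∈ P then p else 0)) * (Fintype.card Q : ℝ)⁻¹)
    (fun a => a.1 ∪ a.2) (fun b => if b.1 then {b.2} else ∅) ?_ ?_ ?_ ?_ ?_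
  · refine key.trans (le_of_eq ?_)
    refine Finset.sum_congr rfl fun f _ => ?_
    congr 1
    refine if_congr (exists_congr fun ω => forall₂_congr fun z _ => ?_) rfl rfl
    cases h : (f z.1).1
    · simp [h]
    · simpa [h] using eq_comm
  · exact fun _ a => mul_nonneg (bernoulliWeight_nonneg hp₁0 hp₁1 _)
      (bernoulliWeight_nonneg hp₁0 hp₁1 _)
  · intro x b
    refine mul_nonneg ?_ (by positivity)
    split_ifs <;> linarith
  · intro x
    rw [Fintype.sum_prod_type]
    simp_rw [← Finset.mul_sum, sum_bernoulliWeight]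
    simp [sum_bernoulliWeight]
  · intro x
    rw [Fintype.sum_prod_type]
    simp
    field_simp
    split_ifs <;> ring
  · intro x A hA
    by_cases hx : x ∈ P
    · have h1 : ∑ b : Bool × Q, ((if b.1 then (if x ∈ P then p else 0)
          else 1 - (if x ∈ P then p else 0)) * (Fintype.card Q : ℝ)⁻¹) *
          (if ∃ c ∈ A, c ∈ (if b.1 then {b.2} else ∅ : Finset Q) then 1 else 0) =
          p * #A / Fintype.card Q := by
        rw [Fintype.sum_prod_type]
        simp [hx]
        ring
      rw [h1]
      have h2 : ∀ a : Finset Q × Finset Q,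
          ((if ∃ c ∈ A, c ∈ a.1 ∪ a.2 then 1 else 0 : ℝ)) ≤
          ∑ c ∈ A, ((if {c} ⊆ a.1 then 1 else 0) + (if {c} ⊆ a.2 then 1 else 0)) := by
        intro a
        split_ifs with h
        · obtain ⟨c, hc, hca⟩ := h
          refine le_trans ?_ (Finset.single_le_sum (fun c _ => by positivity) hc)
          rcases Finset.mem_union.1 hca with h | h
          · simp only [Finset.singleton_subset_iff, h, if_true]
            split_ifs <;> norm_num
          · simp only [Finset.singleton_subset_iff, h, if_true]
            split_ifs <;> norm_num
        · positivity
      calc _ ≤ ∑ a : Finset Q × Finset Q, bernoulliWeight p₁ a.1 * bernoulliWeight p₁ a.2 *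
            ∑ c ∈ A, ((if {c} ⊆ a.1 then 1 else 0) + (if {c} ⊆ a.2 then 1 else 0)) :=
            Finset.sum_le_sum fun a _ => mul_le_mul_of_nonneg_left (h2 a)
              (mul_nonneg (bernoulliWeight_nonneg hp₁0 hp₁1 _)
                (bernoulliWeight_nonneg hp₁0 hp₁1 _))
        _ = ∑ c ∈ A, ((∑ a, bernoulliWeight p₁ a * (if {c} ⊆ a then 1 else 0)) *
              (∑ a : Finset Q, bernoulliWeight p₁ a) + (∑ a : Finset Q, bernoulliWeight p₁ a) *
              ∑ a, bernoulliWeight p₁ a * (if {c} ⊆ a then 1 else 0)) := by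
            rw [Finset.sum_congr rfl fun a _ => Finset.mul_sum _ _ _, Finset.sum_comm]
            refine Finset.sum_congr rfl fun c _ => ?_
            rw [Finset.sum_mul_sum, Finset.sum_mul_sum, ← Finset.sum_add_distrib,
              Fintype.sum_prod_type]
            refine Finset.sum_congr rfl fun a _ => ?_
            rw [← Finset.sum_add_distrib]
            exact Finset.sum_congr rfl fun a _ => by ring
        _ = p * #A / Fintype.card Q := by
            simp_rw [sum_bernoulliWeight_superset, sum_bernoulliWeight]
            simp only [card_singleton, pow_one, sum_const, nsmul_eq_mul]
            rw [hp₁]; field_simp; ring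
        _ ≤ _ := le_rfl
    · have hA' : A = ∅ := by
        refine Finset.eq_empty_of_forall_notMem fun c hc => ?_
        obtain ⟨ω, hω⟩ := hA c hc
        exact hx (hP ω _ hω)
      simp [hA']

end ColoredComparison

section Components

variable {V S : Type*} [Fintype V] [DecidableEq V] [DecidableEq S]

/-- The equivalence relation on `V` generated by joining `a s` and `b s` for `s ∈ J`. -/
def linkSetoid (a b : S → V) (J : Finset S) : Setoid V :=
  Relation.EqvGen.setoid fun u v => ∃ s ∈ J, a s = u ∧ b s = v

/-- A representative of the component of `v` in the multigraph with edges `a s, b s`, `s ∈ J`. -/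
noncomputable def root (a b : S → V) (J : Finset S) (v : V) : V :=
  (Quotient.mk (linkSetoid a b J) v).out

/-- The non-isolated vertices of the multigraph with edges `a s, b s`, `s ∈ J`. -/
def edgeSupport (a b : S → V) (J : Finset S) : Finset V :=
  J.image a ∪ J.image b

/-- Representatives of the nontrivial components of the multigraph with edges `a s, b s`,
`s ∈ J`. -/
noncomputable def roots (a b : S → V) (J : Finset S) : Finset V :=
  (edgeSupport a b J).image (root a b J)

variable {a b : S → V} {J : Finset S}

omit [Fintype V] [DecidableEq V] [DecidableEq S] in
theorem eqvGen_of_root_eq {u v : V} (h : root a b J u = root a b J v) :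
    Relation.EqvGen (fun u v => ∃ s ∈ J, a s = u ∧ b s = v) u v :=
  Quotient.exact (s := linkSetoid a b J) (Quotient.out_inj.1 h)

omit [Fintype V] [DecidableEq V] [DecidableEq S] in
theorem eqvGen_root (v : V) :
    Relation.EqvGen (fun u v => ∃ s ∈ J, a s = u ∧ b s = v) (root a b J v) v :=
  Quotient.mk_out (s := linkSetoid a b J) v

omit [Fintype V] [DecidableEq V] [DecidableEq S] in
theorem root_left_eq_root_right {s : S} (hs : s ∈ J) : root a b J (a s) = root a b J (b s) := by
  have : Quotient.mk (linkSetoid a b J) (a s) = Quotient.mk (linkSetoid a b J) (b s) :=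
    Quotient.sound (Relation.EqvGen.rel _ _ ⟨s, hs, rfl, rfl⟩)
  rw [root, root, this]

omit [Fintype V] [DecidableEq S] in
theorem mem_edgeSupport {v : V} : v ∈ edgeSupport a b J ↔ ∃ s ∈ J, a s = v ∨ b s = v := by
  simp only [edgeSupport, mem_union, mem_image]
  constructor
  · rintro (⟨s, hs, h⟩ | ⟨s, hs, h⟩)
    exacts [⟨s, hs, .inl h⟩, ⟨s, hs, .inr h⟩]
  · rintro ⟨s, hs, h | h⟩
    exacts [.inl ⟨s, hs, h⟩, .inr ⟨s, hs, h⟩]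

omit [Fintype V] [DecidableEq S] in
theorem left_mem_edgeSupport {s : S} (hs : s ∈ J) : a s ∈ edgeSupport a b J :=
  mem_edgeSupport.2 ⟨s, hs, .inl rfl⟩

omit [Fintype V] [DecidableEq S] in
theorem right_mem_edgeSupport {s : S} (hs : s ∈ J) : b s ∈ edgeSupport a b J :=
  mem_edgeSupport.2 ⟨s, hs, .inr rfl⟩

omit [Fintype V] [DecidableEq S] in
theorem card_edgeSupport_le : #(edgeSupport a b J) ≤ 2 * #J := by
  refine (Finset.card_union_le _ _).trans ?_
  have h1 := Finset.card_image_le (s := J) (f := a)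
  have h2 := Finset.card_image_le (s := J) (f := b)
  omega

omit [Fintype V] [DecidableEq S] in
theorem exists_root_left_eq {k : V} (hk : k ∈ roots a b J) : ∃ s ∈ J, root a b J (a s) = k := by
  obtain ⟨v, hv, rfl⟩ := Finset.mem_image.1 hk
  obtain ⟨s, hs, rfl | rfl⟩ := mem_edgeSupport.1 hv
  · exact ⟨s, hs, rfl⟩
  · exact ⟨s, hs, root_left_eq_root_right hs⟩

/-- Embeddings which send each edge of `J` to a pair with difference in `D`: each component can be
placed by choosing the image of its root and one difference per edge. -/
theorem card_embedding_sub_mem_le {G : Type*} [AddCommGroup G] [Fintype G] [DecidableEq G]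
    (hVG : Fintype.card V ≤ Fintype.card G) (a b : S → V) (J : Finset S) (D : Finset G) :
    (#{f : V ↪ G | ∀ s ∈ J, f (a s) - f (b s) ∈ D} : ℝ) ≤
      (Fintype.card G : ℝ) ^ #(roots a b J) * (#D : ℝ) ^ #J *
        ((Real.exp 1 / Fintype.card G) ^ #(edgeSupport a b J) * Fintype.card (V ↪ G)) := by
  set A : Finset (V ↪ G) := univ.filter fun f => ∀ s ∈ J, f (a s) - f (b s) ∈ D with hA
  let code : (V ↪ G) → (roots a b J → G) × (J → G) :=
    fun f => (fun k => f k.1, fun s => f (a s.1) - f (b s.1))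
  let codes : Finset ((roots a b J → G) × (J → G)) := univ ×ˢ Fintype.piFinset fun _ => D
  have hcode : ∀ f ∈ A, code f ∈ codes := by
    intro f hf
    have hf := (Finset.mem_filter.1 hf).2
    simp only [codes, Finset.mem_product, Finset.mem_univ, true_and, Fintype.mem_piFinset]
    exact fun s => hf s.1 s.2
  have hfib : ∀ z ∈ codes, (#{f ∈ A | code f = z} : ℝ) ≤
      (Real.exp 1 / Fintype.card G) ^ #(edgeSupport a b J) * Fintype.card (V ↪ G) := by
    intro z _
    rcases Finset.eq_empty_or_nonempty {f ∈ A | code f = z} with h | ⟨f₀, hf₀⟩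
    · rw [h]; simp; positivity
    refine le_trans ?_ (card_embedding_extending_le_mul hVG (edgeSupport a b J) f₀)
    refine Nat.cast_le.2 (Finset.card_le_card fun f hf => ?_)
    have hz : code f = code f₀ :=
      (Finset.mem_filter.1 hf).2.trans (Finset.mem_filter.1 hf₀).2.symm
    simp only [code, Prod.mk.injEq] at hz
    refine Finset.mem_filter.2 ⟨Finset.mem_univ _, fun v hv => ?_⟩
    have hstep : ∀ u v, Relation.EqvGen (fun u v => ∃ s ∈ J, a s = u ∧ b s = v) u v →
        f u - f v = f₀ u - f₀ v := by
      intro u v huv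
      induction huv with
      | rel u v h =>
        obtain ⟨s, hs, rfl, rfl⟩ := h
        exact congrFun hz.2 ⟨s, hs⟩
      | refl u => simp
      | symm u v _ ih => rw [← neg_sub, ih, neg_sub]
      | trans u v w _ _ ih1 ih2 => rw [← sub_add_sub_cancel _ (f v), ih1, ih2]; abel
    have h1 := hstep _ _ (eqvGen_root (a := a) (b := b) (J := J) v)
    have h2 := congrFun hz.1 ⟨root a b J v, Finset.mem_image_of_mem _ hv⟩
    simp only at h2
    rw [h2] at h1
    exact sub_right_injective h1
  rw [Finset.card_eq_sum_card_fiberwise hcode, Nat.cast_sum]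
  refine (Finset.sum_le_sum hfib).trans (le_of_eq ?_)
  rw [Finset.sum_const, nsmul_eq_mul]
  congr 1
  simp [codes]

omit [Fintype V] [DecidableEq S] in
/-- Comparison of the numbers of edges, vertices and components when the edges which do not cross
a cut point up `h`. -/
theorem card_add_mul_roots_le {r : ℕ} (hr : 1 ≤ r) (a b : S → V) (d : S → ℕ) (J : Finset S)
    (h : V → ℕ) (hd : ∀ s ∈ J, 0 < d s) (hab : ∀ s ∈ J, a s ≠ b s)
    (hinj : ∀ s ∈ J, ∀ s' ∈ J, a s = a s' → d s = d s' → s = s')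
    (hdeg : ∀ x, #{s ∈ J | a s = x} ≤ r) :
    #J + (2 * r - 1) * #(roots a b J) ≤ r * #(edgeSupport a b J) +
      (2 * r - 1) * #{s ∈ J | h (b s) ≠ h (a s) + d s} := by
  set U := edgeSupport a b J with hU
  set ρ := root a b J with hρ
  have hfib : ∀ k ∈ roots a b J, (∑ x ∈ U with ρ x = k, #{s ∈ J | a s = x}) + (2 * r - 1) ≤
      r * #{x ∈ U | ρ x = k} +
        (2 * r - 1) * #{s ∈ {s ∈ J | h (b s) ≠ h (a s) + d s} | ρ (a s) = k} := by
    intro k hk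
    have hle : ∀ F : Finset V, ∑ x ∈ F, #{s ∈ J | a s = x} ≤ r * #F := fun F => by
      rw [mul_comm, ← smul_eq_mul]
      exact Finset.sum_le_card_nsmul _ _ _ fun x _ => hdeg x
    rcases Finset.eq_empty_or_nonempty {s ∈ {s ∈ J | h (b s) ≠ h (a s) + d s} | ρ (a s) = k}
      with hX | hX
    · have hX' : ∀ s ∈ J, ρ (a s) = k → h (b s) = h (a s) + d s := by
        intro s hs hk
        by_contra hne
        exact Finset.notMem_empty s (hX ▸ by simp [hs, hne, hk])
      set F := U.filter fun x => ρ x = k with hF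
      have hbF : ∀ s ∈ J, a s ∈ F → b s ∈ F ∧ h (b s) = h (a s) + d s := by
        intro s hs haF
        have h1 := (Finset.mem_filter.1 haF).2
        refine ⟨Finset.mem_filter.2 ⟨right_mem_edgeSupport hs, ?_⟩, hX' s hs h1⟩
        rw [hρ, ← root_left_eq_root_right hs]; exact h1
      obtain ⟨s₀, hs₀, hk₀⟩ := exists_root_left_eq hk
      have ha₀ : a s₀ ∈ F := Finset.mem_filter.2 ⟨left_mem_edgeSupport hs₀, hk₀⟩
      obtain ⟨x, hxF, hx⟩ := Finset.exists_max_image F h ⟨_, ha₀⟩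
      have hxo : #{s ∈ J | a s = x} = 0 := by
        rw [Finset.card_eq_zero]
        refine Finset.filter_eq_empty_iff.2 fun s hs hsx => ?_
        obtain ⟨h1, h2⟩ := hbF s hs (hsx ▸ hxF)
        have h3 := hx _ h1
        have h4 := hd s hs
        rw [hsx] at h2
        omega
      have hne : (F.erase x).Nonempty := by
        by_cases hax : a s₀ = x
        · refine ⟨b s₀, Finset.mem_erase.2 ⟨?_, (hbF s₀ hs₀ ha₀).1⟩⟩
          rw [← hax]; exact (hab s₀ hs₀).symm
        · exact ⟨_, Finset.mem_erase.2 ⟨hax, ha₀⟩⟩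
      obtain ⟨x', hxF', hx'⟩ := Finset.exists_max_image (F.erase x) h hne
      have hxo' : #{s ∈ J | a s = x'} ≤ 1 := by
        have hbx : ∀ s ∈ J, a s = x' → h x = h x' + d s := by
          intro s hs hsx
          obtain ⟨h1, h2⟩ := hbF s hs (hsx ▸ (Finset.mem_erase.1 hxF').2)
          have h4 := hd s hs
          rw [hsx] at h2
          by_cases hb : b s = x
          · rw [← hb, h2]
          · have := hx' _ (Finset.mem_erase.2 ⟨hb, h1⟩)
            omega
        refine Finset.card_le_one.2 fun s hs s' hs' => ?_
        obtain ⟨h1, h2⟩ := Finset.mem_filter.1 hs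
        obtain ⟨h3, h4⟩ := Finset.mem_filter.1 hs'
        refine hinj s h1 s' h3 (h2.trans h4.symm) ?_
        have h5 := hbx s h1 h2
        have h6 := hbx s' h3 h4
        omega
      have hsum : ∑ y ∈ F, #{s ∈ J | a s = y} ≤ 1 + r * #((F.erase x).erase x') := by
        rw [← Finset.add_sum_erase F _ hxF, ← Finset.add_sum_erase (F.erase x) _ hxF', hxo,
          zero_add]
        exact add_le_add hxo' (hle _)
      have hc1 := Finset.card_erase_add_one hxF
      have hc2 := Finset.card_erase_add_one hxF'
      have hc : r * #F = r * #((F.erase x).erase x') + 2 * r := by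
        rw [← hc1, ← hc2]; ring
      omega
    · have h1 := hle (U.filter fun x => ρ x = k)
      have h2 := Finset.card_pos.2 hX
      have h3 := Nat.mul_le_mul_left (2 * r - 1) h2
      omega
  have h1 : #J = ∑ k ∈ roots a b J, ∑ x ∈ U with ρ x = k, #{s ∈ J | a s = x} := by
    rw [Finset.sum_fiberwise_of_maps_to (t := roots a b J) (fun x (hx : x ∈ U) => Finset.mem_image_of_mem _ hx)]
    exact Finset.card_eq_sum_card_fiberwise fun s hs => left_mem_edgeSupport hs
  have h2 : #U = ∑ k ∈ roots a b J, #{x ∈ U | ρ x = k} :=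
    Finset.card_eq_sum_card_fiberwise fun x hx => Finset.mem_image_of_mem _ hx
  have h3 : #{s ∈ J | h (b s) ≠ h (a s) + d s} =
      ∑ k ∈ roots a b J, #{s ∈ {s ∈ J | h (b s) ≠ h (a s) + d s} | ρ (a s) = k} :=
    Finset.card_eq_sum_card_fiberwise fun s hs =>
      Finset.mem_image_of_mem _ (left_mem_edgeSupport (Finset.mem_filter.1 hs).1)
  rw [h2, h3, Finset.mul_sum, Finset.mul_sum, ← Finset.sum_add_distrib]
  have h4 := Finset.sum_le_sum hfib
  rw [Finset.sum_add_distrib, ← h1, Finset.sum_const, smul_eq_mul, mul_comm (#(roots a b J))] at h4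
  exact h4

end Components

section Enumeration

variable {V S : Type*} [DecidableEq V] [DecidableEq S] {a b : S → V} {J : Finset S}

/-- One edge of `J` from each nontrivial component. -/
noncomputable def seeds (a b : S → V) (J : Finset S) : Finset S :=
  (roots a b J).attach.image fun k => (exists_root_left_eq k.2).choose

theorem seeds_subset : seeds a b J ⊆ J := by
  intro s hs
  obtain ⟨k, _, rfl⟩ := Finset.mem_image.1 hs
  exact (exists_root_left_eq k.2).choose_spec.1

theorem card_seeds : #(seeds a b J) = #(roots a b J) := by
  rw [seeds, Finset.card_image_of_injective, Finset.card_attach]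
  intro k k' h
  simp only at h
  rw [Subtype.ext_iff, ← (exists_root_left_eq k.2).choose_spec.2, h,
    (exists_root_left_eq k'.2).choose_spec.2]

theorem exists_seed {s : S} (hs : s ∈ J) : ∃ s₀ ∈ seeds a b J,
    root a b J (a s₀) = root a b J (a s) := by
  have hk : root a b J (a s) ∈ roots a b J :=
    Finset.mem_image_of_mem _ (left_mem_edgeSupport hs)
  exact ⟨_, Finset.mem_image_of_mem _ (Finset.mem_attach _ ⟨_, hk⟩),
    (exists_root_left_eq hk).choose_spec.2⟩

/-- `J` is generated by its seeds under passing to incident edges. -/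
theorem subset_of_seeds_subset {Q : Finset S} (hQ : seeds a b J ⊆ Q)
    (hclosed : ∀ s ∈ Q, s ∈ J → ∀ s' ∈ J,
      (a s' = a s ∨ a s' = b s ∨ b s' = a s ∨ b s' = b s) → s' ∈ Q) : J ⊆ Q := by
  have hstep : ∀ u v, Relation.EqvGen (fun u v => ∃ s ∈ J, a s = u ∧ b s = v) u v →
      ((∀ s ∈ J, a s = u ∨ b s = u → s ∈ Q) ↔ (∀ s ∈ J, a s = v ∨ b s = v → s ∈ Q)) := by
    intro u v huv
    induction huv with
    | rel u v h =>
      obtain ⟨s, hs, rfl, rfl⟩ := h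
      constructor
      · intro h s' hs' h'
        exact hclosed s (h s hs (.inl rfl)) hs s' hs' (by tauto)
      · intro h s' hs' h'
        exact hclosed s (h s hs (.inr rfl)) hs s' hs' (by tauto)
    | refl u => rfl
    | symm u v _ ih => exact ih.symm
    | trans u v w _ _ ih1 ih2 => exact ih1.trans ih2
  intro s hs
  obtain ⟨s₀, hs₀, h₀⟩ := exists_seed (a := a) (b := b) hs
  have hs₀J := seeds_subset hs₀
  refine (hstep _ _ (eqvGen_of_root_eq h₀)).1 (fun s' hs' h' => ?_) s hs (.inl rfl)
  exact hclosed s₀ (hQ hs₀) hs₀J s' hs' (by tauto)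

/-- The number of edge sets of size `t` with given seeds is at most exponential in `t`. -/
theorem card_filter_seeds_le [Fintype S] (a b : S → V) {m : ℕ} (N : S → Finset S)
    (hN : ∀ s s', (a s' = a s ∨ a s' = b s ∨ b s' = a s ∨ b s' = b s) → s' ∈ N s)
    (hm : ∀ s, #(N s) ≤ m) (B : Finset S) (t : ℕ) :
    #{J : Finset S | #J = t ∧ seeds a b J = B} ≤ 2 ^ (m * t) := by
  set F : Finset (Finset S) := univ.filter fun J => #J = t ∧ seeds a b J = B with hF
  let M : Finset S → Finset S := fun J => J.biUnion N
  have hJM : ∀ J : Finset S, J ⊆ M J := fun J s hs =>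
    Finset.mem_biUnion.2 ⟨s, hs, hN s s (.inl rfl)⟩
  let 𝒜 : Finset S → Finset (Finset S) := fun J => univ.filter fun A => A ∩ M J = J
  have hcard : ∀ J ∈ F, 2 ^ Fintype.card S ≤ #(𝒜 J) * 2 ^ (m * t) := by
    intro J hJ
    have hJt := (Finset.mem_filter.1 hJ).2.1
    have hM : #(M J) ≤ m * t := by
      rw [← hJt, mul_comm]
      exact Finset.card_biUnion_le_card_mul _ _ _ fun s _ => hm s
    have h1 : #((univ \ M J).powerset) ≤ #(𝒜 J) := by
      refine Finset.card_le_card_of_injOn (fun Q => Q ∪ J) ?_ ?_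
      · intro Q hQ
        have hQ : Q ⊆ univ \ M J := Finset.mem_powerset.1 hQ
        refine Finset.mem_filter.2 ⟨Finset.mem_univ _, ?_⟩
        ext s
        have h1 := @hQ s
        have h2 := @hJM J s
        simp only [mem_sdiff, mem_univ, true_and] at h1
        simp only [mem_inter, mem_union]
        tauto
      · intro Q hQ Q' hQ' h
        have hQ : Q ⊆ univ \ M J := Finset.mem_powerset.1 hQ
        have hQ' : Q' ⊆ univ \ M J := Finset.mem_powerset.1 hQ'
        ext s
        have h1 := @hQ s
        have h1' := @hQ' s
        have h2 := @hJM J s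
        have h3 : s ∈ Q ∪ J ↔ s ∈ Q' ∪ J := by simp only at h; rw [h]
        simp only [mem_sdiff, mem_univ, true_and] at h1 h1'
        simp only [mem_union] at h3
        tauto
    rw [Finset.card_powerset] at h1
    calc 2 ^ Fintype.card S ≤ 2 ^ (#(univ \ M J) + m * t) := by
          refine Nat.pow_le_pow_right (by norm_num) ?_
          have := Finset.card_sdiff_add_card_eq_card (Finset.subset_univ (M J))
          rw [Finset.card_univ] at this
          omega
      _ ≤ #(𝒜 J) * 2 ^ (m * t) := by
          rw [pow_add]
          exact Nat.mul_le_mul_right _ h1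
  have hsub : ∀ J ∈ F, ∀ J' ∈ F, ∀ A, A ∈ 𝒜 J → A ∈ 𝒜 J' → J ⊆ J' := by
    intro J hJ J' hJ' A hA hA'
    have hA : A ∩ M J = J := (Finset.mem_filter.1 hA).2
    have hA' : A ∩ M J' = J' := (Finset.mem_filter.1 hA').2
    have hB : seeds a b J = B := (Finset.mem_filter.1 hJ).2.2
    have hB' : seeds a b J' = B := (Finset.mem_filter.1 hJ').2.2
    refine subset_of_seeds_subset (a := a) (b := b) (hB.trans hB'.symm ▸ seeds_subset) ?_
    intro s hs _ s' hs' h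
    rw [← hA']
    refine Finset.mem_inter.2 ⟨?_, Finset.mem_biUnion.2 ⟨s, hs, hN s s' h⟩⟩
    rw [← hA] at hs'
    exact (Finset.mem_inter.1 hs').1
  have hdisj : (F : Set (Finset S)).PairwiseDisjoint 𝒜 := by
    intro J hJ J' hJ' hne
    refine Finset.disjoint_left.2 fun A hA hA' => hne ?_
    exact (hsub J hJ J' hJ' A hA hA').antisymm (hsub J' hJ' J hJ A hA' hA)
  have h1 : ∑ J ∈ F, #(𝒜 J) ≤ 2 ^ Fintype.card S := by
    rw [← Finset.card_biUnion (fun J hJ J' hJ' h => hdisj hJ hJ' h), ← Fintype.card_finset]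
    exact Finset.card_le_univ _
  have h2 : #F * 2 ^ Fintype.card S ≤ 2 ^ Fintype.card S * 2 ^ (m * t) :=
    calc #F * 2 ^ Fintype.card S = ∑ J ∈ F, 2 ^ Fintype.card S := by simp
      _ ≤ ∑ J ∈ F, #(𝒜 J) * 2 ^ (m * t) := Finset.sum_le_sum hcard
      _ = (∑ J ∈ F, #(𝒜 J)) * 2 ^ (m * t) := (Finset.sum_mul _ _ _).symm
      _ ≤ _ := Nat.mul_le_mul_right _ h1
  rw [mul_comm] at h2
  exact Nat.le_of_mul_le_mul_left h2 (by positivity)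

theorem sum_pow_card_roots_le [Fintype S] (a b : S → V) {m : ℕ} (N : S → Finset S)
    (hN : ∀ s s', (a s' = a s ∨ a s' = b s ∨ b s' = a s ∨ b s' = b s) → s' ∈ N s)
    (hm : ∀ s, #(N s) ≤ m) (J₀ : Finset S) (t : ℕ) {y : ℝ} (hy : 0 ≤ y) :
    ∑ J ∈ powersetCard t J₀, y ^ #(roots a b J) ≤ 2 ^ (m * t) * Real.exp (y * #J₀) := by
  have hmaps : ∀ J ∈ powersetCard t J₀, seeds a b J ∈ J₀.powerset := fun J hJ =>
    Finset.mem_powerset.2 (seeds_subset.trans (Finset.mem_powersetCard.1 hJ).1)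
  rw [← Finset.sum_fiberwise_of_maps_to hmaps]
  calc _ ≤ ∑ B ∈ J₀.powerset, 2 ^ (m * t) * y ^ #B := by
        refine Finset.sum_le_sum fun B _ => ?_
        have h1 : ∀ J ∈ {J ∈ powersetCard t J₀ | seeds a b J = B},
            y ^ #(roots a b J) = y ^ #B := fun J hJ => by
          rw [← card_seeds, (Finset.mem_filter.1 hJ).2]
        rw [Finset.sum_congr rfl h1, Finset.sum_const, nsmul_eq_mul]
        refine mul_le_mul_of_nonneg_right ?_ (by positivity)
        have h2 := card_filter_seeds_le a b N hN hm B t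
        have h3 : #{J ∈ powersetCard t J₀ | seeds a b J = B} ≤
            #{J : Finset S | #J = t ∧ seeds a b J = B} := by
          refine Finset.card_le_card fun J hJ => ?_
          obtain ⟨h4, h5⟩ := Finset.mem_filter.1 hJ
          exact Finset.mem_filter.2 ⟨Finset.mem_univ _, (Finset.mem_powersetCard.1 h4).2, h5⟩
        exact_mod_cast h3.trans h2
    _ = 2 ^ (m * t) * (y + 1) ^ #J₀ := by
        rw [← Finset.mul_sum, ← Finset.sum_pow_mul_eq_add_pow]
        simp
    _ ≤ _ := by
        refine mul_le_mul_of_nonneg_left ?_ (by positivity)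
        rw [mul_comm, Real.exp_nat_mul]
        exact pow_le_pow_left₀ (by positivity) (Real.add_one_le_exp y) _

end Enumeration

section Slots

variable {n r : ℕ} [NeZero n]

/-- The second endpoint of the pair `{i, i + d + 1}` encoded by the slot `(i, d)`. -/
def slotEnd (s : ZMod n × Fin r) : ZMod n := s.1 + ((s.2 + 1 : ℕ) : ZMod n)

omit [NeZero n] in
theorem natCast_inj_of_lt {k l : ℕ} (hk : k < n) (hl : l < n)
    (h : (k : ZMod n) = (l : ZMod n)) : k = l := by
  have := congrArg ZMod.val h
  rwa [ZMod.val_natCast_of_lt hk, ZMod.val_natCast_of_lt hl] at this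

omit [NeZero n] in
theorem fst_ne_slotEnd (hn : 2 * r < n) (s : ZMod n × Fin r) : s.1 ≠ slotEnd s := by
  intro h
  have h1 : (((s.2 : ℕ) + 1 : ℕ) : ZMod n) = ((0 : ℕ) : ZMod n) := by
    rw [slotEnd, left_eq_add] at h
    simpa using h
  have := natCast_inj_of_lt (by have := s.2.2; omega) (by have := s.2.2; omega) h1
  omega

omit [NeZero n] in
theorem card_filter_fst_eq_le (F : Finset (ZMod n × Fin r)) (x : ZMod n) :
    #{s ∈ F | s.1 = x} ≤ r := by
  calc _ ≤ #(univ : Finset (Fin r)) := by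
        refine Finset.card_le_card_of_injOn Prod.snd (fun _ _ => Finset.mem_univ _) ?_
        intro s hs s' hs' h
        have h1 := (Finset.mem_filter.1 (Finset.mem_coe.1 hs)).2
        have h2 := (Finset.mem_filter.1 (Finset.mem_coe.1 hs')).2
        exact Prod.ext (h1.trans h2.symm) h
    _ = r := by simp

omit [NeZero n] in
theorem card_filter_slotEnd_eq_le (F : Finset (ZMod n × Fin r)) (x : ZMod n) :
    #{s ∈ F | slotEnd s = x} ≤ r := by
  calc _ ≤ #(univ : Finset (Fin r)) := by
        refine Finset.card_le_card_of_injOn Prod.snd (fun _ _ => Finset.mem_univ _) ?_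
        intro s hs s' hs' h
        have h1 := (Finset.mem_filter.1 (Finset.mem_coe.1 hs)).2
        have h2 := (Finset.mem_filter.1 (Finset.mem_coe.1 hs')).2
        refine Prod.ext ?_ h
        have h3 := h1.trans h2.symm
        rw [slotEnd, slotEnd, h] at h3
        exact add_right_cancel h3
    _ = r := by simp

/-- The slots sharing a vertex with `s`. -/
noncomputable def slotNeighbors (s : ZMod n × Fin r) : Finset (ZMod n × Fin r) :=
  univ.filter fun s' => s'.1 = s.1 ∨ s'.1 = slotEnd s ∨ slotEnd s' = s.1 ∨ slotEnd s' = slotEnd s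

theorem card_slotNeighbors_le (s : ZMod n × Fin r) : #(slotNeighbors s) ≤ 4 * r := by
  rw [slotNeighbors, Finset.filter_or, Finset.filter_or, Finset.filter_or]
  have h1 := card_filter_fst_eq_le univ s.1 (r := r)
  have h2 := card_filter_fst_eq_le univ (slotEnd s) (r := r)
  have h3 := card_filter_slotEnd_eq_le univ s.1 (r := r)
  have h4 := card_filter_slotEnd_eq_le univ (slotEnd s) (r := r)
  refine (Finset.card_union_le _ _).trans ?_
  refine (Nat.add_le_add_left ((Finset.card_union_le _ _).trans
    (Nat.add_le_add_left (Finset.card_union_le _ _) _)) _).trans ?_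
  omega

theorem sum_pow_card_slot_roots_le (J₀ : Finset (ZMod n × Fin r)) (t : ℕ) {y : ℝ} (hy : 0 ≤ y) :
    ∑ J ∈ powersetCard t J₀, y ^ #(roots Prod.fst slotEnd J) ≤
      2 ^ (4 * r * t) * Real.exp (y * #J₀) :=
  sum_pow_card_roots_le Prod.fst slotEnd slotNeighbors
    (fun _ _ h => Finset.mem_filter.2 ⟨Finset.mem_univ _, h⟩) card_slotNeighbors_le J₀ t hy

theorem card_cross_le (d : ℕ) (x : ZMod n) :
    #{a : ZMod n | (x + (d : ZMod n) - a).val ≠ (x - a).val + d} ≤ d := by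
  calc _ ≤ #(Ico (n - d) n) := by
        refine Finset.card_le_card_of_injOn (fun a => (x - a).val) ?_ ?_
        · intro a ha
          have ha := (Finset.mem_filter.1 (Finset.mem_coe.1 ha)).2
          have h1 := ZMod.val_lt (x - a)
          refine Finset.mem_coe.2 (Finset.mem_Ico.2 ⟨?_, h1⟩)
          by_contra! h2
          refine ha ?_
          have h3 : x + (d : ZMod n) - a = (((x - a).val + d : ℕ) : ZMod n) := by
            push_cast
            rw [ZMod.natCast_zmod_val]
            ring
          rw [h3, ZMod.val_natCast_of_lt (by omega)]
        · intro a _ a' _ h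
          have := ZMod.val_injective n h
          exact sub_right_injective this
    _ ≤ d := by rw [Nat.card_Ico]; omega

/-- Some cut point of the cycle is crossed by few edges. -/
theorem exists_cut (J : Finset (ZMod n × Fin r)) : ∃ a : ZMod n,
    n * #{s ∈ J | (slotEnd s - a).val ≠ (s.1 - a).val + ((s.2 : ℕ) + 1)} ≤ r * #J := by
  have h1 : ∑ a : ZMod n, #{s ∈ J | (slotEnd s - a).val ≠ (s.1 - a).val + ((s.2 : ℕ) + 1)} ≤
      r * #J := by
    simp_rw [Finset.card_filter]
    rw [Finset.sum_comm]
    simp_rw [← Finset.card_filter]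
    rw [mul_comm, ← smul_eq_mul]
    exact Finset.sum_le_card_nsmul _ _ _ fun s _ => (card_cross_le _ _).trans (by omega)
  obtain ⟨a, -, ha⟩ := Finset.exists_le_of_sum_le (s := (univ : Finset (ZMod n)))
    (f := fun a => n * #{s ∈ J | (slotEnd s - a).val ≠ (s.1 - a).val + ((s.2 : ℕ) + 1)})
    (g := fun _ => r * #J) ⟨0, Finset.mem_univ _⟩ (by
      rw [← Finset.mul_sum, Finset.sum_const, smul_eq_mul, Finset.card_univ, ZMod.card]
      exact Nat.mul_le_mul_left _ h1)
  exact ⟨a, ha⟩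

/-- The rank inequality for sets of edges of the `r`-th power of a cycle. -/
theorem exists_rank_bound (hr : 1 ≤ r) (hn : 2 * r < n) (J : Finset (ZMod n × Fin r)) :
    ∃ X : ℕ, n * X ≤ r * #J ∧ #J + (2 * r - 1) * #(roots Prod.fst slotEnd J) ≤
      r * #(edgeSupport Prod.fst slotEnd J) + (2 * r - 1) * X := by
  obtain ⟨a, ha⟩ := exists_cut J
  refine ⟨_, ha, card_add_mul_roots_le hr Prod.fst slotEnd (fun s => (s.2 : ℕ) + 1) J
    (fun x => (x - a).val) (fun s _ => by omega) (fun s _ => fst_ne_slotEnd hn s) ?_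
    (card_filter_fst_eq_le J)⟩
  intro s _ s' _ h1 h2
  exact Prod.ext h1 (Fin.ext (by omega))

theorem rpow_rank_bound (hr : 1 ≤ r) {t c v X : ℕ} (hX : n * X ≤ r * t)
    (h : t + (2 * r - 1) * c ≤ r * v + (2 * r - 1) * X) :
    (n : ℝ) ^ c * ((n : ℝ) ^ v)⁻¹ ≤
      (Real.exp (2 * r - 1) * (n : ℝ) ^ (-(1 : ℝ) / r)) ^ t *
        ((n : ℝ) ^ (-((r : ℝ) - 1) / r)) ^ c := by
  have hn0 : (0 : ℝ) < n := by exact_mod_cast NeZero.pos n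
  have hr0 : (0 : ℝ) < r := by exact_mod_cast hr
  have hr1 : (1 : ℝ) ≤ r := by exact_mod_cast hr
  have hlog : 0 ≤ Real.log n := Real.log_nonneg (by exact_mod_cast NeZero.one_le)
  have hlogn : Real.log n ≤ n := (Real.log_le_sub_one_of_pos hn0).trans (by linarith)
  have e0 : ∀ k : ℕ, (n : ℝ) ^ k = Real.exp (k * Real.log n) := fun k => by
    rw [Real.exp_nat_mul, Real.exp_log hn0]
  rw [Real.rpow_def_of_pos hn0, Real.rpow_def_of_pos hn0, ← Real.exp_add, ← Real.exp_nat_mul,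
    ← Real.exp_nat_mul, e0, e0, ← Real.exp_neg, ← Real.exp_add, ← Real.exp_add,
    Real.exp_le_exp]
  have h' : (t : ℝ) + (2 * r - 1) * c ≤ r * v + (2 * r - 1) * X := by
    have : ((2 * r - 1 : ℕ) : ℝ) = 2 * r - 1 := by
      rw [Nat.cast_sub (by omega)]; push_cast; ring
    rw [← this]; exact_mod_cast h
  have hX' : (n : ℝ) * X ≤ r * t := by exact_mod_cast hX
  have h1 : X * Real.log n ≤ r * t := by
    refine le_trans ?_ hX'
    rw [mul_comm]
    exact mul_le_mul_of_nonneg_right hlogn (by positivity)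
  have h2 := mul_le_mul_of_nonneg_left h1 (by linarith : (0 : ℝ) ≤ 2 * r - 1)
  have h3 := mul_le_mul_of_nonneg_right h' hlog
  refine le_of_mul_le_mul_left ?_ hr0
  have e1 : (r : ℝ) * (c * Real.log n + -(v * Real.log n)) =
    r * c * Real.log n - r * v * Real.log n := by ring
  have e2 : (r : ℝ) * (t * (2 * r - 1 + Real.log n * (-1 / r)) +
      c * (Real.log n * (-((r : ℝ) - 1) / r))) =
    (2 * r - 1) * (r * t) - t * Real.log n - (r - 1) * c * Real.log n := by
    field_simp
    ring
  rw [e1, e2]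
  nlinarith

/-- The number of embeddings of the cycle which send each edge of `J` to an edge of the `r`-th
power of the cycle. -/
theorem card_embedding_slots_le (hr : 1 ≤ r) (hn : 2 * r < n) (J : Finset (ZMod n × Fin r))
    (D : Finset (ZMod n)) (hD : #D ≤ 2 * r + 1) :
    (#{f : ZMod n ↪ ZMod n | ∀ s ∈ J, f s.1 - f (slotEnd s) ∈ D} : ℝ) ≤
      ((2 * r + 1) * Real.exp 2 * Real.exp (2 * r - 1) * (n : ℝ) ^ (-(1 : ℝ) / r)) ^ #J *
        ((n : ℝ) ^ (-((r : ℝ) - 1) / r)) ^ #(roots Prod.fst slotEnd J) *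
        Fintype.card (ZMod n ↪ ZMod n) := by
  obtain ⟨X, hX, hJ⟩ := exists_rank_bound hr hn J
  have h1 := rpow_rank_bound hr hX hJ
  have h2 := card_embedding_sub_mem_le le_rfl Prod.fst slotEnd J D
  refine le_trans (le_of_eq ?_) (h2.trans ?_)
  · congr!
  rw [ZMod.card, ← mul_assoc]
  refine mul_le_mul_of_nonneg_right ?_ (by positivity)
  have hD' : (#D : ℝ) ≤ 2 * r + 1 := by exact_mod_cast hD
  have hv := card_edgeSupport_le (a := Prod.fst) (b := slotEnd) (J := J)
  have he : Real.exp 1 ^ #(edgeSupport Prod.fst slotEnd J) ≤ Real.exp 2 ^ #J := by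
    rw [← Real.exp_nat_mul, ← Real.exp_nat_mul, Real.exp_le_exp]
    have : (#(edgeSupport Prod.fst slotEnd J) : ℝ) ≤ 2 * #J := by exact_mod_cast hv
    linarith
  calc (n : ℝ) ^ #(roots Prod.fst slotEnd J) * (#D : ℝ) ^ #J *
        (Real.exp 1 / n) ^ #(edgeSupport Prod.fst slotEnd J) =
        (#D : ℝ) ^ #J * Real.exp 1 ^ #(edgeSupport Prod.fst slotEnd J) *
        ((n : ℝ) ^ #(roots Prod.fst slotEnd J) *
          ((n : ℝ) ^ #(edgeSupport Prod.fst slotEnd J))⁻¹) := by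
        rw [div_pow]; ring
    _ ≤ (2 * r + 1) ^ #J * Real.exp 2 ^ #J *
        ((Real.exp (2 * r - 1) * (n : ℝ) ^ (-(1 : ℝ) / r)) ^ #J *
          ((n : ℝ) ^ (-((r : ℝ) - 1) / r)) ^ #(roots Prod.fst slotEnd J)) := by
        gcongr
    _ = _ := by simp only [mul_pow]; ring

end Slots

section Spread

variable {n r q : ℕ} [NeZero n]

/-- The image under `σ` of the edge encoded by the slot `s`. -/
def slotEdge (σ : Equiv.Perm (ZMod n)) (s : ZMod n × Fin r) : Finset (ZMod n) :=
  {σ s.1, σ (slotEnd s)}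

/-- The colored edges of the `r`-th power of the Hamilton cycle `σ` colored by `c`. -/
def coloredPower (ω : Equiv.Perm (ZMod n) × ((ZMod n × Fin r) ↪ Fin q)) :
    Finset (Finset (ZMod n) × Fin q) :=
  univ.map ⟨fun s => (slotEdge ω.1 s, ω.2 s), fun _ _ h => ω.2.injective (Prod.ext_iff.1 h).2⟩

theorem mem_coloredPower {ω : Equiv.Perm (ZMod n) × ((ZMod n × Fin r) ↪ Fin q)}
    {z : Finset (ZMod n) × Fin q} :
    z ∈ coloredPower ω ↔ ∃ s, slotEdge ω.1 s = z.1 ∧ ω.2 s = z.2 := by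
  simp only [coloredPower, mem_map, mem_univ, true_and]
  exact exists_congr fun s => Prod.ext_iff

theorem card_coloredPower (ω : Equiv.Perm (ZMod n) × ((ZMod n × Fin r) ↪ Fin q)) :
    #(coloredPower ω) = n * r := by
  simp [coloredPower, ZMod.card]

omit [NeZero n] in
theorem eq_or_eq_of_pair_eq {V : Type*} [DecidableEq V] {u v x y : V}
    (h : ({u, v} : Finset V) = {x, y}) : (u = x ∧ v = y) ∨ (u = y ∧ v = x) := by
  rw [← Finset.coe_inj, Finset.coe_pair, Finset.coe_pair] at h
  exact Set.pair_eq_pair_iff.1 h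

omit [NeZero n] in
theorem slotEdge_injective (hn : 2 * r < n) (σ : Equiv.Perm (ZMod n)) :
    Function.Injective (slotEdge (r := r) σ) := by
  intro s s' h
  have hs := s.2.2
  have hs' := s'.2.2
  rcases eq_or_eq_of_pair_eq h with ⟨h1, h2⟩ | ⟨h1, h2⟩
  · have h1 := σ.injective h1
    have h2 := σ.injective h2
    rw [slotEnd, slotEnd, h1] at h2
    have := natCast_inj_of_lt (by omega) (by omega) (add_left_cancel h2)
    exact Prod.ext h1 (Fin.ext (by omega))
  · have h1 := σ.injective h1
    have h2 := σ.injective h2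
    exfalso
    have h3 : (((s.2 + 1) + (s'.2 + 1) : ℕ) : ZMod n) = ((0 : ℕ) : ZMod n) := by
      rw [slotEnd] at h1 h2
      rw [h1, add_assoc, add_eq_left] at h2
      push_cast at h2 ⊢
      rw [← h2]; ring
    have := natCast_inj_of_lt (by omega) (by omega) h3
    omega

/-- The differences of the endpoints of edges of the `r`-th power of the cycle. -/
noncomputable def slotDiffs (n r : ℕ) : Finset (ZMod n) :=
  (Icc (-(r : ℤ)) (r : ℤ)).image (Int.cast : ℤ → ZMod n)

omit [NeZero n] in
theorem card_slotDiffs_le : #(slotDiffs n r) ≤ 2 * r + 1 := by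
  refine Finset.card_image_le.trans ?_
  rw [Int.card_Icc]
  omega

omit [NeZero n] in
theorem sub_mem_slotDiffs {σ : Equiv.Perm (ZMod n)} {u v : ZMod n} {s : ZMod n × Fin r}
    (h : slotEdge σ s = {u, v}) : σ.symm u - σ.symm v ∈ slotDiffs n r := by
  have hs := s.2.2
  rcases eq_or_eq_of_pair_eq h with ⟨rfl, rfl⟩ | ⟨rfl, rfl⟩
  · refine Finset.mem_image.2 ⟨-((s.2 : ℤ) + 1), Finset.mem_Icc.2 ⟨by omega, by omega⟩, ?_⟩
    simp [slotEnd]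
  · refine Finset.mem_image.2 ⟨(s.2 : ℤ) + 1, Finset.mem_Icc.2 ⟨by omega, by omega⟩, ?_⟩
    simp [slotEnd]

theorem card_colorings_le (hn : 2 * r < n) (hq : r * n ≤ q) (σ σ' : Equiv.Perm (ZMod n))
    (c : (ZMod n × Fin r) ↪ Fin q) (J : Finset (ZMod n × Fin r)) :
    (#{c' : (ZMod n × Fin r) ↪ Fin q |
      ∀ s ∈ J, (slotEdge σ s, c s) ∈ coloredPower (σ', c')} : ℝ) ≤
      (if ∀ s ∈ J, ∃ s' : ZMod n × Fin r, slotEdge σ' s' = slotEdge σ s then 1 else 0) *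
        ((Real.exp 1 / q) ^ #J * Fintype.card ((ZMod n × Fin r) ↪ Fin q)) := by
  split_ifs with h
  · rw [one_mul]
    choose! g hg using h
    have hgJ : Set.InjOn g J := fun s hs s' hs' h =>
      slotEdge_injective hn σ (by rw [← hg s hs, h, hg s' hs'])
    rcases Finset.eq_empty_or_nonempty ({c' : (ZMod n × Fin r) ↪ Fin q |
      ∀ s ∈ J, (slotEdge σ s, c s) ∈ coloredPower (σ', c')} : Finset _) with h0 | ⟨c₀, hc₀⟩
    · rw [h0]; simp; positivity
    have hcol : ∀ c' : (ZMod n × Fin r) ↪ Fin q,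
        (∀ s ∈ J, (slotEdge σ s, c s) ∈ coloredPower (σ', c')) → ∀ s ∈ J, c' (g s) = c s := by
      intro c' hc' s hs
      obtain ⟨s', h1, h2⟩ := mem_coloredPower.1 (hc' s hs)
      rw [← slotEdge_injective hn σ' (h1.trans (hg s hs).symm)]
      exact h2
    have hcard : Fintype.card (ZMod n × Fin r) ≤ Fintype.card (Fin q) := by
      simpa [ZMod.card, mul_comm] using hq
    have h1 := card_embedding_extending_le_mul hcard (J.image g) c₀
    rw [Finset.card_image_of_injOn hgJ, Fintype.card_fin] at h1
    refine le_trans (Nat.cast_le.2 (Finset.card_le_card fun c' hc' => ?_)) h1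
    refine Finset.mem_filter.2 ⟨Finset.mem_univ _, fun u hu => ?_⟩
    obtain ⟨s, hs, rfl⟩ := Finset.mem_image.1 hu
    rw [hcol c' (Finset.mem_filter.1 hc').2 s hs, hcol c₀ (Finset.mem_filter.1 hc₀).2 s hs]
  · rw [zero_mul]
    refine le_of_eq ?_
    rw [Nat.cast_eq_zero, Finset.card_eq_zero, Finset.filter_eq_empty_iff]
    intro c' _ hc'
    refine h fun s hs => ?_
    obtain ⟨s', h1, -⟩ := mem_coloredPower.1 (hc' s hs)
    exact ⟨s', h1⟩

theorem card_coloredPower_superset_le (hr : 1 ≤ r) (hn : 2 * r < n) (hq : r * n ≤ q)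
    (σ : Equiv.Perm (ZMod n)) (c : (ZMod n × Fin r) ↪ Fin q) (J : Finset (ZMod n × Fin r)) :
    (#{ω' : Equiv.Perm (ZMod n) × ((ZMod n × Fin r) ↪ Fin q) |
      ∀ s ∈ J, (slotEdge σ s, c s) ∈ coloredPower ω'} : ℝ) ≤
      ((2 * r + 1) * Real.exp 2 * Real.exp (2 * r - 1) * Real.exp 1 *
        ((n : ℝ) ^ (-(1 : ℝ) / r) / q)) ^ #J *
        ((n : ℝ) ^ (-((r : ℝ) - 1) / r)) ^ #(roots Prod.fst slotEnd J) *
        Fintype.card (Equiv.Perm (ZMod n) × ((ZMod n × Fin r) ↪ Fin q)) := by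
  have h1 : (#{σ' : Equiv.Perm (ZMod n) |
      ∀ s ∈ J, ∃ s' : ZMod n × Fin r, slotEdge σ' s' = slotEdge σ s} : ℝ) ≤
      ((2 * r + 1) * Real.exp 2 * Real.exp (2 * r - 1) * (n : ℝ) ^ (-(1 : ℝ) / r)) ^ #J *
        ((n : ℝ) ^ (-((r : ℝ) - 1) / r)) ^ #(roots Prod.fst slotEnd J) *
        Fintype.card (Equiv.Perm (ZMod n)) := by
    have h2 := card_embedding_slots_le hr hn J (slotDiffs n r) card_slotDiffs_le
    have h3 : Fintype.card (ZMod n ↪ ZMod n) = Fintype.card (Equiv.Perm (ZMod n)) := by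
      rw [Fintype.card_embedding_eq, Nat.descFactorial_self, Fintype.card_perm]
    rw [h3] at h2
    refine le_trans (Nat.cast_le.2 ?_) h2
    refine Finset.card_le_card_of_injOn (fun σ' => (σ.trans σ'.symm).toEmbedding) ?_ ?_
    · intro σ' hσ'
      have hσ' := (Finset.mem_filter.1 (Finset.mem_coe.1 hσ')).2
      refine Finset.mem_coe.2 (Finset.mem_filter.2 ⟨Finset.mem_univ _, fun s hs => ?_⟩)
      obtain ⟨s', hs'⟩ := hσ' s hs
      exact sub_mem_slotDiffs hs'
    · intro σ' _ σ'' _ h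
      have h4 : ∀ x, σ'.symm (σ x) = σ''.symm (σ x) := fun x => DFunLike.congr_fun h x
      have h5 : σ'.symm = σ''.symm := Equiv.ext fun x => by simpa using h4 (σ.symm x)
      exact Equiv.symm_bijective.injective h5
  have h2 : (#{ω' : Equiv.Perm (ZMod n) × ((ZMod n × Fin r) ↪ Fin q) |
      ∀ s ∈ J, (slotEdge σ s, c s) ∈ coloredPower ω'} : ℝ) =
      ∑ σ' : Equiv.Perm (ZMod n), (#{c' : (ZMod n × Fin r) ↪ Fin q |
        ∀ s ∈ J, (slotEdge σ s, c s) ∈ coloredPower (σ', c')} : ℝ) := by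
    simp_rw [Finset.card_filter]
    push_cast
    rw [Fintype.sum_prod_type]
  rw [h2]
  refine (Finset.sum_le_sum fun σ' _ => card_colorings_le hn hq σ σ' c J).trans ?_
  rw [← Finset.sum_mul, Finset.sum_boole, Fintype.card_prod, Nat.cast_mul]
  refine (mul_le_mul_of_nonneg_right h1 (by positivity)).trans (le_of_eq ?_)
  simp only [mul_pow, div_pow]
  ring

/-- The family of colored powers of Hamilton cycles is spread. -/
theorem coloredPower_spread (hr : 1 ≤ r) (hn : 2 * r < n) (hq : r * n ≤ q)
    (ω : Equiv.Perm (ZMod n) × ((ZMod n × Fin r) ↪ Fin q))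
    (T : Finset (Finset (ZMod n) × Fin q)) (hT : T ⊆ coloredPower ω) (t : ℕ) :
    ∑ I ∈ powersetCard t T, (#{ω' : Equiv.Perm (ZMod n) × ((ZMod n × Fin r) ↪ Fin q) |
      I ⊆ coloredPower ω'} : ℝ) ≤
      (2 ^ (4 * r) * ((2 * r + 1) * Real.exp 2 * Real.exp (2 * r - 1) * Real.exp 1) *
        ((n : ℝ) ^ (-(1 : ℝ) / r) / q)) ^ t *
        Real.exp ((n : ℝ) ^ (-((r : ℝ) - 1) / r) * #T) *
        Fintype.card (Equiv.Perm (ZMod n) × ((ZMod n × Fin r) ↪ Fin q)) := by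
  obtain ⟨σ, c⟩ := ω
  obtain ⟨J₀, -, rfl⟩ := Finset.subset_map_iff.1 hT
  rw [Finset.powersetCard_map, Finset.sum_map, Finset.card_map]
  have h1 := sum_pow_card_slot_roots_le J₀ t
    (by positivity : (0 : ℝ) ≤ (n : ℝ) ^ (-((r : ℝ) - 1) / r))
  set C : ℝ := (2 * r + 1) * Real.exp 2 * Real.exp (2 * r - 1) * Real.exp 1 with hC
  calc _ ≤ ∑ J ∈ powersetCard t J₀, (C * ((n : ℝ) ^ (-(1 : ℝ) / r) / q)) ^ t *
        ((n : ℝ) ^ (-((r : ℝ) - 1) / r)) ^ #(roots Prod.fst slotEnd J) *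
        Fintype.card (Equiv.Perm (ZMod n) × ((ZMod n × Fin r) ↪ Fin q)) := by
        refine Finset.sum_le_sum fun J hJ => ?_
        have h2 := card_coloredPower_superset_le hr hn hq σ c J
        rw [(Finset.mem_powersetCard.1 hJ).2] at h2
        refine le_trans (Nat.cast_le.2 (Finset.card_le_card fun ω' hω' => ?_)) h2
        refine Finset.mem_filter.2 ⟨Finset.mem_univ _, fun s hs => ?_⟩
        refine (Finset.mem_filter.1 hω').2 ?_
        simp only
        exact Finset.mem_map_of_mem _ hs
    _ = (C * ((n : ℝ) ^ (-(1 : ℝ) / r) / q)) ^ t *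
        Fintype.card (Equiv.Perm (ZMod n) × ((ZMod n × Fin r) ↪ Fin q)) *
        ∑ J ∈ powersetCard t J₀,
          ((n : ℝ) ^ (-((r : ℝ) - 1) / r)) ^ #(roots Prod.fst slotEnd J) := by
        rw [Finset.mul_sum]
        exact Finset.sum_congr rfl fun J _ => by ring
    _ ≤ (C * ((n : ℝ) ^ (-(1 : ℝ) / r) / q)) ^ t *
        Fintype.card (Equiv.Perm (ZMod n) × ((ZMod n × Fin r) ↪ Fin q)) *
        (2 ^ (4 * r * t) * Real.exp ((n : ℝ) ^ (-((r : ℝ) - 1) / r) * #J₀)) := by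
        refine mul_le_mul_of_nonneg_left h1 (by positivity)
    _ = _ := by
        rw [pow_mul]
        simp only [mul_pow]
        ring

end Spread

section Threshold

theorem powEdge_eq_slotEdge {n r : ℕ} [NeZero n] (σ : Equiv.Perm (ZMod n)) (i : ℕ) {d : ℕ}
    (hd : 1 ≤ d) (hdr : d ≤ r) :
    powEdge n σ i d = slotEdge σ ((i : ZMod n), (⟨d - 1, by omega⟩ : Fin r)) := by
  simp only [powEdge, slotEdge, slotEnd]
  rw [Nat.sub_add_cancel hd, Nat.cast_add]

theorem card_slotEdge {n r : ℕ} [NeZero n] (hn : 2 * r < n) (σ : Equiv.Perm (ZMod n))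
    (s : ZMod n × Fin r) : #(slotEdge σ s) = 2 :=
  Finset.card_pair (σ.injective.ne (fst_ne_slotEnd hn s))

theorem two_round_le_rainbowPowHamProb {n r q : ℕ} [NeZero n] [NeZero q] (hn : 2 * r < n) {p : ℝ}
    (hp : 0 ≤ p) (hp1 : p ≤ 1) :
    ∑ W : Finset (Finset (ZMod n) × Fin q), ∑ V : Finset (Finset (ZMod n) × Fin q),
      bernoulliWeight (p / (2 * q)) W * bernoulliWeight (p / (2 * q)) V *
        (if ∃ ω : Equiv.Perm (ZMod n) × ((ZMod n × Fin r) ↪ Fin q), coloredPower ω ⊆ W ∪ V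
          then 1 else 0) ≤ rainbowPowHamProb n r q p := by
  have h := two_round_le_random_coloring (Q := Fin q)
    (Finset.univ.filter fun S : Finset (ZMod n) => S.card = 2)
    (fun ω : Equiv.Perm (ZMod n) × ((ZMod n × Fin r) ↪ Fin q) => coloredPower ω) ?_ ?_ hp hp1
  · rw [Fintype.card_fin] at h
    refine le_trans (le_of_eq ?_) (h.trans ?_)
    · congr!
    rw [rainbowPowHamProb]
    refine Finset.sum_le_sum fun E _ => ?_
    refine Finset.sum_le_sum fun c _ => ?_
    refine mul_le_mul_of_nonneg_left ?_ ?_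
    · split_ifs with h1 h2 h2
      · rfl
      · refine absurd ?_ h2
        obtain ⟨⟨σ, c'⟩, hω⟩ := h1
        have hs : ∀ s, slotEdge σ s ∈ E ∧ c (slotEdge σ s) = c' s := fun s =>
          hω (slotEdge σ s, c' s) (mem_coloredPower.2 ⟨s, rfl, rfl⟩)
        refine ⟨σ, fun i _ d hd hdr => ?_, fun i _ d hd hdr i' _ d' hd' hdr' hc => ?_⟩
        · rw [powEdge_eq_slotEdge σ i hd hdr]
          exact (hs _).1
        · rw [powEdge_eq_slotEdge σ i hd hdr, powEdge_eq_slotEdge σ i' hd' hdr'] at hc ⊢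
          rw [(hs _).2, (hs _).2] at hc
          rw [c'.injective hc]
      · exact zero_le_one
      · rfl
    · have : 0 ≤ 1 - p := by linarith
      positivity
  · intro ω x c c' hc hc'
    obtain ⟨s, h1, h2⟩ := mem_coloredPower.1 hc
    obtain ⟨s', h3, h4⟩ := mem_coloredPower.1 hc'
    rw [slotEdge_injective hn ω.1 (h1.trans h3.symm)] at h2
    exact h2.symm.trans h4
  · intro ω z hz
    obtain ⟨s, h1, -⟩ := mem_coloredPower.1 hz
    rw [← h1]
    exact Finset.mem_filter.2 ⟨Finset.mem_univ _, card_slotEdge hn ω.1 s⟩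

theorem one_sub_le_rainbowPowHamProb {n r q : ℕ} [NeZero n] (hr : 2 ≤ r) (hn : 2 * r < n)
    (hq : r * n ≤ q) {K θ : ℝ} (hK : 0 < K) (hθ1 : Real.exp 1 * θ ≤ 1 / 2)
    (hp1 : K * (n : ℝ) ^ (-(1 : ℝ) / (r : ℝ)) ≤ 1)
    (hKθ : K * θ =
      2 * (2 ^ (4 * r) * ((2 * r + 1) * Real.exp 2 * Real.exp (2 * r - 1) * Real.exp 1))) :
    1 - 4 * (Real.exp 1 + Real.exp (r + 1)) * θ ≤
      rainbowPowHamProb n r q (K * (n : ℝ) ^ (-(1 : ℝ) / (r : ℝ))) := by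
  have hn0 : (0 : ℝ) < n := by exact_mod_cast NeZero.pos n
  have hn1 : (1 : ℝ) ≤ n := by exact_mod_cast NeZero.one_le
  have hr2 : (2 : ℝ) ≤ r := by exact_mod_cast hr
  have hr0 : (r : ℝ) ≠ 0 := by linarith
  have hqpos : 0 < q := lt_of_lt_of_le (Nat.mul_pos (by omega) (NeZero.pos n)) hq
  have : NeZero q := ⟨hqpos.ne'⟩
  have hq1 : (1 : ℝ) ≤ q := by exact_mod_cast hqpos
  have hq0 : (0 : ℝ) < q := by linarith
  have hθ : 0 ≤ θ := by
    refine nonneg_of_mul_nonneg_right (?_ : 0 ≤ K * θ) hK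
    rw [hKθ]
    positivity
  set x : ℝ := (n : ℝ) ^ (-(1 : ℝ) / (r : ℝ)) with hx
  have hx0 : 0 < x := Real.rpow_pos_of_pos hn0 _
  refine le_trans ?_ (two_round_le_rainbowPowHamProb (q := q) hn (by positivity) hp1)
  set p₁ := K * x / (2 * q) with hp₁
  have hp₁0 : 0 < p₁ := by positivity
  have hp₁1 : p₁ ≤ 1 := by
    rw [hp₁, div_le_one (by positivity)]; linarith
  have hne : Nonempty ((ZMod n × Fin r) ↪ Fin q) :=
    Function.Embedding.nonempty_of_card_le (by simpa [ZMod.card, mul_comm] using hq)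
  set y : ℝ := (n : ℝ) ^ (-((r : ℝ) - 1) / r) with hy
  have hy0 : 0 < y := Real.rpow_pos_of_pos hn0 _
  have hyn : y * n = (n : ℝ) ^ ((1 : ℝ) / r) := by
    rw [hy, ← Real.rpow_add_one hn0.ne']
    congr 1
    field_simp
    ring
  have hy1 : y ≤ 1 := Real.rpow_le_one_of_one_le_of_nonpos hn1
    (div_nonpos_of_nonpos_of_nonneg (by linarith) (by linarith))
  have hyy : y * (y * n) ≤ 1 := by
    rw [hyn, hy, ← Real.rpow_add hn0]
    refine Real.rpow_le_one_of_one_le_of_nonpos hn1 ?_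
    rw [← add_div]
    exact div_nonpos_of_nonpos_of_nonneg (by linarith) (by linarith)
  have key := two_round_bound
    (fun ω : Equiv.Perm (ZMod n) × ((ZMod n × Fin r) ↪ Fin q) => coloredPower ω)
    (p := p₁) (θ := θ) (y := y) (b := r + 1) (ℓ := ⌈y * (n * r)⌉₊) hp₁0 hp₁1 hθ hθ1 hy0.le
    (fun ω => by
      rw [card_coloredPower, Nat.cast_mul]
      exact Nat.le_ceil _)
    (by
      have h1 := Nat.ceil_lt_add_one (a := y * (n * r)) (by positivity)
      calc y * ⌈y * (n * r)⌉₊ ≤ y * (y * (n * r) + 1) :=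
            mul_le_mul_of_nonneg_left h1.le hy0.le
        _ = (y * (y * n)) * r + y := by ring
        _ ≤ 1 * r + 1 := by gcongr
        _ = r + 1 := by ring)
    (fun ω T hT t => by
      have h1 := coloredPower_spread (by omega) hn hq ω T hT t
      have h2 : θ * p₁ =
          2 ^ (4 * r) * ((2 * r + 1) * Real.exp 2 * Real.exp (2 * r - 1) * Real.exp 1) *
            (x / q) := by
        rw [hp₁, mul_div_assoc', ← mul_assoc, mul_comm θ K, hKθ]
        field_simp
      rw [h2]
      exact h1)
  have htot : ∑ W : Finset (Finset (ZMod n) × Fin q), ∑ V : Finset (Finset (ZMod n) × Fin q),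
      bernoulliWeight p₁ W * bernoulliWeight p₁ V = 1 := by
    rw [← Finset.sum_mul_sum, sum_bernoulliWeight, one_mul]
  have hsplit : ∀ (A : Prop) [Decidable A],
      (if A then 1 else 0 : ℝ) = 1 - (if A then 0 else 1) := fun A _ => by
    split_ifs <;> norm_num
  simp_rw [hsplit, mul_sub, mul_one, Finset.sum_sub_distrib]
  rw [htot]
  exact sub_le_sub_left key 1

end Threshold

/-- For every `ε > 0` and `r ≥ 2` there are `K' = K'(r,ε)` and `n₀` such that for all
`n ≥ n₀`: if the edges of `G(n,p)` with `p = K' n^{-1/r}` are colored independently and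
uniformly at random with `q ≥ rn` colors, then with probability at least `1 - ε` the
resulting graph contains a rainbow `r`-th power of a Hamilton cycle. -/
theorem rainbow_power_hamilton (ε : ℝ) (hε : 0 < ε) (r : ℕ) (hr : 2 ≤ r) :
    ∃ K' : ℝ, 0 < K' ∧ ∃ n₀ : ℕ, ∀ (n : ℕ) [NeZero n], n₀ ≤ n →
      ∀ qc : ℕ, r * n ≤ qc →
        1 - ε ≤ rainbowPowHamProb n r qc (K' * (n : ℝ) ^ (-(1 : ℝ) / (r : ℝ))) := by
  set C : ℝ := 2 * (2 ^ (4 * r) *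
    ((2 * r + 1) * Real.exp 2 * Real.exp (2 * r - 1) * Real.exp 1)) with hC
  have hC0 : 0 < C := by positivity
  set θ : ℝ := min (1 / (2 * Real.exp 1)) (ε / (4 * (Real.exp 1 + Real.exp (r + 1)))) with hθ
  have hθ0 : 0 < θ := lt_min (by positivity) (by positivity)
  have hθ1 : Real.exp 1 * θ ≤ 1 / 2 := by
    calc Real.exp 1 * θ ≤ Real.exp 1 * (1 / (2 * Real.exp 1)) :=
          mul_le_mul_of_nonneg_left (min_le_left _ _) (Real.exp_pos 1).le
      _ = 1 / 2 := by field_simp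
  have hθ2 : 4 * (Real.exp 1 + Real.exp (r + 1)) * θ ≤ ε := by
    have h := min_le_right (1 / (2 * Real.exp 1)) (ε / (4 * (Real.exp 1 + Real.exp (r + 1))))
    rw [← hθ, le_div_iff₀ (by positivity)] at h
    linarith
  have hr0 : 0 < r := by omega
  refine ⟨C / θ, by positivity, max (2 * r + 1) ⌈(C / θ) ^ r⌉₊, fun n _ hn q hq => ?_⟩
  have hn1 : 2 * r < n := (le_max_left _ _).trans hn
  have hn2 : (C / θ) ^ r ≤ n := Nat.ceil_le.1 ((le_max_right _ _).trans hn)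
  have hp1 : C / θ * (n : ℝ) ^ (-(1 : ℝ) / (r : ℝ)) ≤ 1 := by
    have hn0 : (0 : ℝ) < n := by exact_mod_cast NeZero.pos n
    rw [neg_div, Real.rpow_neg hn0.le, ← div_eq_mul_inv,
      div_le_one (Real.rpow_pos_of_pos hn0 _), one_div]
    calc C / θ = ((C / θ) ^ r) ^ ((r : ℝ)⁻¹) :=
          (Real.pow_rpow_inv_natCast (by positivity) hr0.ne').symm
      _ ≤ (n : ℝ) ^ ((r : ℝ)⁻¹) := Real.rpow_le_rpow (by positivity) hn2 (by positivity)
  refine le_trans (by linarith) (one_sub_le_rainbowPowHamProb hr hn1 hq (by positivity) hθ1 hp1 ?_)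
  rw [div_mul_cancel₀ _ hθ0.ne']
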